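/- arXiv:1305.5193 — 3 statements merged into one kernel-verified Lean document; each statement's English description precedes it below -/
import Mathlib

section
/- Let ψ and f be holomorphic functions on the open unit disc 𝔻 ⊂ ℂ such that ∫_𝔻 |f(z)|² dxdy < ∞, ∫_𝔻 |ψ'(z)|² dxdy < ∞, and ∫_𝔻 |ψ(z)|²|f(z)|² dxdy < ∞. Then the infimum, over all holomorphic functions g on 𝔻 with ∫_𝔻 |g|² dxdy < ∞, of ∫_𝔻 |conj(ψ(z))·f(z) − g(z)|² dxdy is at most (1/(2π)) · (∫_𝔻 |ψ'(z)|² dxdy) · (∫_𝔻 |f(z)|² dxdy). (This is the main theorem for α = 0: the Hankel operator H_{conj ψ} on the Bergman space A²(𝔻) has norm at most ‖ψ'‖_{A²(𝔻)}/√2, since ‖(I−P)(conj(ψ)f)‖ equals the L²-distance from conj(ψ)f to the Bergman space.) -/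
open MeasureTheory Complex

theorem integral_ball_norm_pow (n : ℕ) :
    ∫ z in Metric.ball (0 : ℂ) 1, ‖z‖ ^ (2 * n) = Real.pi / (n + 1) := by
  have h := integral_fun_norm_addHaar (volume : Measure ℂ)
    (fun r => (Set.Iio (1:ℝ)).indicator (fun r => r ^ (2 * n)) r)
  have h1 : ∀ z : ℂ, (Set.Iio (1:ℝ)).indicator (fun r => r ^ (2 * n)) ‖z‖ =
      (Metric.ball (0 : ℂ) 1).indicator (fun z => ‖z‖ ^ (2 * n)) z := by
    intro z
    simp [Set.indicator]
  simp_rw [h1] at h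
  rw [integral_indicator measurableSet_ball] at h
  rw [h]
  have h2 : ∀ y : ℝ, y ^ (Module.finrank ℝ ℂ - 1) • (Set.Iio (1:ℝ)).indicator (fun r => r ^ (2 * n)) y
      = (Set.Iio (1:ℝ)).indicator (fun r => r ^ (2 * n + 1)) y := by
    intro y
    simp [Set.indicator, Complex.finrank_real_complex, pow_succ, mul_comm]
  simp_rw [h2]
  rw [setIntegral_indicator measurableSet_Iio, Set.Ioi_inter_Iio, ← integral_Ioc_eq_integral_Ioo,
    ← intervalIntegral.integral_of_le zero_le_one, integral_pow]
  simp [Measure.real, Complex.finrank_real_complex]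
  field_simp
  ring

theorem integral_ball_pow_mul_conj_pow (i j : ℕ) :
    ∫ z in Metric.ball (0 : ℂ) 1, z ^ i * (starRingEnd ℂ) z ^ j =
      if i = j then ((Real.pi / (i + 1) : ℝ) : ℂ) else 0 := by
  split_ifs with h
  · subst h
    rw [← integral_ball_norm_pow, ← integral_complex_ofReal]
    congr 1
    ext z
    rw [← mul_pow, Complex.mul_conj, pow_mul, Complex.normSq_eq_norm_sq]
    push_cast
    rfl
  · set ω : Circle := Circle.exp (Real.pi / ((i:ℝ) - j)) with hω
    have hij : (i:ℝ) - j ≠ 0 := sub_ne_zero.mpr (by exact_mod_cast h)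
    have hω' : (ω : ℂ) ^ i * (starRingEnd ℂ) (ω : ℂ) ^ j = -1 := by
      rw [hω, Circle.coe_exp, ← Complex.exp_conj, ← Complex.exp_nat_mul, ← Complex.exp_nat_mul,
        ← Complex.exp_add, ← Complex.exp_pi_mul_I]
      congr 1
      have : (i:ℂ) - j ≠ 0 := by exact_mod_cast hij
      simp
      field_simp
      ring
    have key := (rotation ω).measurePreserving.setIntegral_preimage_emb
      (rotation ω).toHomeomorph.measurableEmbedding (fun z => z ^ i * (starRingEnd ℂ) z ^ j)
      (Metric.ball (0 : ℂ) 1)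
    have hb : (rotation ω) ⁻¹' (Metric.ball (0 : ℂ) 1) = Metric.ball 0 1 := by
      ext z
      rw [Set.mem_preimage, mem_ball_zero_iff, mem_ball_zero_iff, LinearIsometryEquiv.norm_map]
    rw [hb] at key
    have h3 : ∀ z : ℂ, rotation ω z ^ i * (starRingEnd ℂ) (rotation ω z) ^ j
        = - (z ^ i * (starRingEnd ℂ) z ^ j) := by
      intro z
      rw [rotation_apply, map_mul, mul_pow, mul_pow]
      linear_combination (z ^ i * (starRingEnd ℂ) z ^ j) * hω'
    simp_rw [h3] at key
    rw [integral_neg] at key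
    exact self_eq_neg.mp key.symm

theorem integrableOn_ball_of_continuous {E : Type*} [NormedAddCommGroup E] {h : ℂ → E}
    (hh : Continuous h) : IntegrableOn h (Metric.ball (0 : ℂ) 1) :=
  (hh.continuousOn.integrableOn_compact (isCompact_closedBall 0 1)).mono_set
    Metric.ball_subset_closedBall

theorem integral_ball_normSq_sum {ι : Type*} (s : Finset ι) (c : ι → ℂ) (φ : ι → ℂ → ℂ)
    (hφ : ∀ i, Continuous (φ i)) :
    ((∫ z in Metric.ball (0 : ℂ) 1, ‖∑ i ∈ s, c i * φ i z‖ ^ 2 : ℝ) : ℂ) =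
      ∑ i ∈ s, ∑ j ∈ s, c i * (starRingEnd ℂ) (c j) *
        ∫ z in Metric.ball (0 : ℂ) 1, φ i z * (starRingEnd ℂ) (φ j z) := by
  have hcont : ∀ i j, Continuous fun z => φ i z * (starRingEnd ℂ) (φ j z) := fun i j =>
    (hφ i).mul (Complex.continuous_conj.comp (hφ j))
  have h1 : ∀ z, ((‖∑ i ∈ s, c i * φ i z‖ ^ 2 : ℝ) : ℂ) =
      ∑ i ∈ s, ∑ j ∈ s, c i * (starRingEnd ℂ) (c j) * (φ i z * (starRingEnd ℂ) (φ j z)) := by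
    intro z
    push_cast
    rw [← Complex.mul_conj', map_sum, Finset.sum_mul_sum]
    refine Finset.sum_congr rfl fun i _ => Finset.sum_congr rfl fun j _ => ?_
    rw [map_mul]
    ring
  rw [← integral_complex_ofReal]
  simp_rw [h1]
  rw [integral_finsetSum]
  · refine Finset.sum_congr rfl fun i _ => ?_
    rw [integral_finsetSum]
    · refine Finset.sum_congr rfl fun j _ => ?_
      rw [integral_const_mul]
    · exact fun j _ => (integrableOn_ball_of_continuous (hcont i j)).const_mul _
  · exact fun i _ => integrable_finsetSum _ fun j _ =>
      (integrableOn_ball_of_continuous (hcont i j)).const_mul _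

theorem integral_ball_normSq_polynomial (K : ℕ) (b : ℕ → ℂ) :
    ∫ z in Metric.ball (0 : ℂ) 1, ‖∑ n ∈ Finset.range K, b n * z ^ n‖ ^ 2 =
      Real.pi * ∑ n ∈ Finset.range K, ‖b n‖ ^ 2 / (n + 1) := by
  have h := integral_ball_normSq_sum (Finset.range K) b (fun n z => z ^ n)
    (fun n => continuous_pow n)
  simp_rw [map_pow, integral_ball_pow_mul_conj_pow] at h
  rw [← Complex.ofReal_inj, h]
  push_cast
  rw [Finset.mul_sum]
  refine Finset.sum_congr rfl fun i hi => ?_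
  rw [Finset.sum_eq_single i]
  · rw [if_pos rfl, Complex.mul_conj']
    ring
  · intro j _ hj
    rw [if_neg (Ne.symm hj), mul_zero]
  · exact fun h => absurd hi h

/-- The component of `conj z ^ m * z ^ n` orthogonal to the Bergman space of the disc. -/
noncomputable def hankelMonomial (m n : ℕ) (z : ℂ) : ℂ :=
  z ^ n * (starRingEnd ℂ) z ^ m - ((n + 1 - m : ℕ) : ℂ) / (n + 1) * z ^ (n - m)

theorem continuous_hankelMonomial (m n : ℕ) : Continuous (hankelMonomial m n) := by
  unfold hankelMonomial
  have := Complex.continuous_conj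
  fun_prop

/-- The Gram matrix of the family `hankelMonomial`, divided by `π`. -/
noncomputable def hankelGram (m n m' n' : ℕ) : ℝ :=
  if n + m' = n' + m then
    if n < m then 1 / (n' + m + 1) else m * m' / ((n' + m + 1) * (n + 1) * (n' + 1))
  else 0

theorem hankelGram_nonneg (m n m' n' : ℕ) : 0 ≤ hankelGram m n m' n' := by
  unfold hankelGram
  split_ifs <;> positivity

theorem hankelGram_comm (m n m' n' : ℕ) : hankelGram m n m' n' = hankelGram m' n' m n := by
  unfold hankelGram
  by_cases h : n + m' = n' + m
  · have h2 : (n < m) ↔ (n' < m') := by omega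
    have h3 : (n : ℝ) + m' = n' + m := by exact_mod_cast h
    rw [if_pos h, if_pos h.symm, h3]
    simp only [h2]
    congr 1
    ring
  · rw [if_neg h, if_neg (Ne.symm h)]

theorem integral_ball_hankelMonomial (m n m' n' : ℕ) :
    ∫ z in Metric.ball (0 : ℂ) 1, hankelMonomial m n z * (starRingEnd ℂ) (hankelMonomial m' n' z) =
      ((Real.pi * hankelGram m n m' n' : ℝ) : ℂ) := by
  have hc := Complex.continuous_conj
  have hI : ∀ i j : ℕ, IntegrableOn (fun z : ℂ => z ^ i * (starRingEnd ℂ) z ^ j)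
      (Metric.ball (0 : ℂ) 1) := fun i j => integrableOn_ball_of_continuous (by fun_prop)
  set α : ℂ := ((n + 1 - m : ℕ) : ℂ) / (n + 1) with hα
  set β : ℂ := ((n' + 1 - m' : ℕ) : ℂ) / (n' + 1) with hβ
  have hβ' : (starRingEnd ℂ) β = β := by simp [hβ]
  have h1 : ∀ z, hankelMonomial m n z * (starRingEnd ℂ) (hankelMonomial m' n' z) =
      z ^ (n + m') * (starRingEnd ℂ) z ^ (m + n')
      - β * (z ^ n * (starRingEnd ℂ) z ^ (m + (n' - m')))
      - α * (z ^ (n - m + m') * (starRingEnd ℂ) z ^ n')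
      + α * β * (z ^ (n - m) * (starRingEnd ℂ) z ^ (n' - m')) := by
    intro z
    simp only [hankelMonomial, map_sub, map_mul, map_pow, Complex.conj_conj, ← hα, ← hβ, hβ']
    ring
  simp_rw [h1]
  rw [integral_add, integral_sub, integral_sub, integral_const_mul, integral_const_mul,
    integral_const_mul]
  rotate_left
  · exact hI _ _
  · exact (hI _ _).const_mul _
  · exact (hI _ _).sub ((hI _ _).const_mul _)
  · exact (hI _ _).const_mul _
  · exact ((hI _ _).sub ((hI _ _).const_mul _)).sub ((hI _ _).const_mul _)
  · exact (hI _ _).const_mul _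
  simp_rw [integral_ball_pow_mul_conj_pow]
  unfold hankelGram
  by_cases h : n + m' = n' + m
  · rw [if_pos h, if_pos (by omega)]
    have h3 : (n : ℂ) + m' = n' + m := by exact_mod_cast h
    have hN : (n' : ℂ) + m + 1 ≠ 0 := by exact_mod_cast Nat.succ_ne_zero (n' + m)
    by_cases hlt : n < m
    · have e1 : n + 1 - m = 0 := by omega
      have e2 : n' + 1 - m' = 0 := by omega
      simp only [hα, hβ, e1, e2, if_pos hlt]
      push_cast
      rw [h3]
      ring
    · obtain ⟨d, rfl⟩ : ∃ d, n = m + d := ⟨n - m, by omega⟩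
      obtain rfl : n' = m' + d := by omega
      have e1 : m + d + 1 - m = d + 1 := by omega
      have e2 : m' + d + 1 - m' = d + 1 := by omega
      have hd : (d : ℂ) + 1 ≠ 0 := by exact_mod_cast Nat.succ_ne_zero d
      have hn : (m : ℂ) + d + 1 ≠ 0 := by exact_mod_cast Nat.succ_ne_zero (m + d)
      have hn' : (m' : ℂ) + d + 1 ≠ 0 := by exact_mod_cast Nat.succ_ne_zero (m' + d)
      rw [if_neg hlt, if_pos (by omega), if_pos (by omega), if_pos (by omega)]
      simp only [hα, hβ, e1, e2, Nat.add_sub_cancel_left]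
      push_cast at hN ⊢
      have hN2 : (m : ℂ) + d + m' + 1 ≠ 0 := by
        intro h0; apply hN; linear_combination h0
      have hn2 : (d : ℂ) + m' + 1 ≠ 0 := by
        intro h0; apply hn'; linear_combination h0
      field_simp
      ring
  · rw [if_neg h, if_neg (by omega)]
    have t1 : β * (if n = m + (n' - m') then ((Real.pi / (n + 1) : ℝ) : ℂ) else 0) = 0 := by
      by_cases hlt : n' < m'
      · have e2 : n' + 1 - m' = 0 := by omega
        simp [hβ, e2]
      · rw [if_neg (by omega), mul_zero]
    have t2 : α * (if n - m + m' = n' then ((Real.pi / ((n - m + m' : ℕ) + 1) : ℝ) : ℂ) else 0)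
        = 0 := by
      by_cases hlt : n < m
      · have e2 : n + 1 - m = 0 := by omega
        simp [hα, e2]
      · rw [if_neg (by omega), mul_zero]
    have t3 : α * β * (if n - m = n' - m' then ((Real.pi / ((n - m : ℕ) + 1) : ℝ) : ℂ) else 0)
        = 0 := by
      by_cases hlt : n < m
      · have e2 : n + 1 - m = 0 := by omega
        simp [hα, e2]
      · by_cases hlt : n' < m'
        · have e2 : n' + 1 - m' = 0 := by omega
          simp [hβ, e2]
        · rw [if_neg (by omega), mul_zero]
    rw [t1, t2, t3]
    simp

theorem sum_range_natCast_add_one (m : ℕ) :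
    ∑ n ∈ Finset.range m, ((n : ℝ) + 1) = m * (m + 1) / 2 := by
  induction m with
  | zero => simp
  | succ k ih =>
    rw [Finset.sum_range_succ, ih]
    push_cast
    ring

theorem sum_range_sub_natCast (k : ℕ) :
    ∑ n ∈ Finset.range (k + 1), ((k : ℝ) - n) = k * (k + 1) / 2 := by
  induction k with
  | zero => simp
  | succ k ih =>
    rw [Finset.sum_range_succ']
    push_cast
    simp only [add_sub_add_right_eq_sub]
    rw [ih]
    ring

/-- Schur test for `hankelGram` with the weight `n + 1`. -/
theorem sum_hankelGram_mul_le (K m n' : ℕ) :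
    ∑ p ∈ Finset.range K ×ˢ Finset.range K, hankelGram m p.2 p.1 n' * (p.2 + 1) ≤ m / 2 := by
  set w : ℕ → ℝ := fun n =>
    if n < m then (1 / (n' + m + 1) : ℝ) * (n + 1)
    else m * (n' + m - n) / ((n' + m + 1) * (n' + 1)) with hw
  have hwnn : ∀ n ∈ Finset.range (m + (n' + 1)), 0 ≤ w n := by
    intro n hn
    have : (n : ℝ) ≤ n' + m := by
      have := Finset.mem_range.mp hn
      exact_mod_cast (by omega : n ≤ n' + m)
    have : 0 ≤ (n' : ℝ) + m - n := by linarith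
    simp only [hw]
    split_ifs <;> positivity
  have hsum : ∑ n ∈ Finset.range (m + (n' + 1)), w n = m / 2 := by
    rw [Finset.sum_range_add]
    have e1 : ∑ n ∈ Finset.range m, w n = 1 / (n' + m + 1) * (m * (m + 1) / 2) := by
      rw [← sum_range_natCast_add_one, Finset.mul_sum]
      refine Finset.sum_congr rfl fun n hn => ?_
      simp only [hw, if_pos (Finset.mem_range.mp hn)]
    have e2 : ∑ n ∈ Finset.range (n' + 1), w (m + n) =
        m / ((n' + m + 1) * (n' + 1)) * (n' * (n' + 1) / 2) := by
      rw [← sum_range_sub_natCast, Finset.mul_sum]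
      refine Finset.sum_congr rfl fun n hn => ?_
      simp only [hw, if_neg (by omega : ¬ m + n < m)]
      push_cast
      ring
    rw [e1, e2]
    field_simp
    ring
  have hterm : ∀ n, ∑ m' ∈ Finset.range K, hankelGram m n m' n' * ((n : ℝ) + 1) ≤
      if n ∈ Finset.range (m + (n' + 1)) then w n else 0 := by
    intro n
    split_ifs with hn
    · have hn := Finset.mem_range.mp hn
      have hnn := hwnn n (Finset.mem_range.mpr hn)
      have h0 : ∀ m' ∈ Finset.range K, hankelGram m n m' n' * ((n : ℝ) + 1) =
          if m' = n' + m - n then w n else 0 := by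
        intro m' _
        unfold hankelGram
        by_cases h : n + m' = n' + m
        · have h3 : (n : ℝ) + m' = n' + m := by exact_mod_cast h
          have h5 : (n' : ℝ) + m - n = m' := by linarith
          rw [if_pos h, if_pos (by omega : m' = n' + m - n)]
          simp only [hw]
          split_ifs
          · rfl
          · rw [h5]
            field_simp
        · rw [if_neg h, if_neg (by omega), zero_mul]
      rw [Finset.sum_congr rfl h0, Finset.sum_ite_eq']
      split_ifs
      · exact le_rfl
      · exact hnn
    · refine (Finset.sum_eq_zero fun m' _ => ?_).le
      have : ¬ n + m' = n' + m := by
        have := mt Finset.mem_range.mpr hn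
        omega
      rw [hankelGram, if_neg this, zero_mul]
  rw [Finset.sum_product_right]
  calc _ ≤ ∑ n ∈ Finset.range K, if n ∈ Finset.range (m + (n' + 1)) then w n else 0 :=
        Finset.sum_le_sum fun n _ => hterm n
    _ = ∑ n ∈ Finset.range K ∩ Finset.range (m + (n' + 1)), w n := by
        rw [Finset.sum_ite_mem]
    _ ≤ ∑ n ∈ Finset.range (m + (n' + 1)), w n :=
        Finset.sum_le_sum_of_subset_of_nonneg Finset.inter_subset_right fun n hn _ => hwnn n hn
    _ = m / 2 := hsum

theorem integral_ball_hankel_polynomial_le (K : ℕ) (a b : ℕ → ℂ) :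
    ∫ z in Metric.ball (0 : ℂ) 1,
      ‖∑ p ∈ Finset.range K ×ˢ Finset.range K,
        ((starRingEnd ℂ) (a p.1) * b p.2) * hankelMonomial p.1 p.2 z‖ ^ 2 ≤
    Real.pi / 2 * ((∑ m ∈ Finset.range K, m * ‖a m‖ ^ 2) *
      ∑ n ∈ Finset.range K, ‖b n‖ ^ 2 / (n + 1)) := by
  set S := Finset.range K ×ˢ Finset.range K with hS
  have h := integral_ball_normSq_sum S (fun p => (starRingEnd ℂ) (a p.1) * b p.2)
    (fun p => hankelMonomial p.1 p.2) (fun p => continuous_hankelMonomial _ _)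
  simp_rw [integral_ball_hankelMonomial] at h
  set I := ∫ z in Metric.ball (0 : ℂ) 1,
      ‖∑ p ∈ S, ((starRingEnd ℂ) (a p.1) * b p.2) * hankelMonomial p.1 p.2 z‖ ^ 2 with hI
  have h1 : I ≤ ∑ p ∈ S, ∑ q ∈ S, (‖a p.1‖ * ‖b p.2‖) * (‖a q.1‖ * ‖b q.2‖) *
      (Real.pi * hankelGram p.1 p.2 q.1 q.2) := by
    calc I ≤ ‖(I : ℂ)‖ := by rw [Complex.norm_real]; exact le_abs_self _
      _ ≤ _ := by
        rw [h]
        refine (norm_sum_le _ _).trans (Finset.sum_le_sum fun p _ => ?_)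
        refine (norm_sum_le _ _).trans (Finset.sum_le_sum fun q _ => ?_)
        rw [norm_mul, norm_mul, norm_mul, RCLike.norm_conj, RCLike.norm_conj, norm_mul,
          RCLike.norm_conj, Complex.norm_real,
          Real.norm_of_nonneg (mul_nonneg Real.pi_pos.le (hankelGram_nonneg _ _ _ _))]
  set T : ℕ × ℕ → ℕ × ℕ → ℝ := fun p q =>
    (‖a p.1‖ ^ 2 * ‖b q.2‖ ^ 2 / (q.2 + 1)) * (Real.pi *
      (hankelGram p.1 p.2 q.1 q.2 * (p.2 + 1))) with hT
  have h2 : ∀ p q : ℕ × ℕ, (‖a p.1‖ * ‖b p.2‖) * (‖a q.1‖ * ‖b q.2‖) *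
      (Real.pi * hankelGram p.1 p.2 q.1 q.2) ≤ (T p q + T q p) / 2 := by
    intro p q
    simp only [hT]
    rw [hankelGram_comm q.1 q.2 p.1 p.2]
    have hG : 0 ≤ Real.pi * hankelGram p.1 p.2 q.1 q.2 :=
      mul_nonneg Real.pi_pos.le (hankelGram_nonneg _ _ _ _)
    set G := hankelGram p.1 p.2 q.1 q.2
    set X := ‖a p.1‖ * ‖b q.2‖
    set Y := ‖a q.1‖ * ‖b p.2‖
    set s : ℝ := p.2 + 1
    set t : ℝ := q.2 + 1
    have hs : 0 < s := by positivity
    have ht : 0 < t := by positivity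
    have key : X * Y ≤ (X ^ 2 / t * s + Y ^ 2 / s * t) / 2 := by
      have : (X ^ 2 / t * s + Y ^ 2 / s * t) / 2 - X * Y = (X * s - Y * t) ^ 2 / (2 * s * t) := by
        field_simp
        ring
      have : 0 ≤ (X * s - Y * t) ^ 2 / (2 * s * t) := by positivity
      linarith
    calc _ = X * Y * (Real.pi * G) := by ring
      _ ≤ (X ^ 2 / t * s + Y ^ 2 / s * t) / 2 * (Real.pi * G) :=
          mul_le_mul_of_nonneg_right key hG
      _ = _ := by ring
  have h3 : I ≤ ∑ p ∈ S, ∑ q ∈ S, T p q := by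
    have hsw : ∑ p ∈ S, ∑ q ∈ S, T q p = ∑ p ∈ S, ∑ q ∈ S, T p q := Finset.sum_comm
    calc I ≤ _ := h1
      _ ≤ ∑ p ∈ S, ∑ q ∈ S, (T p q + T q p) / 2 :=
          Finset.sum_le_sum fun p _ => Finset.sum_le_sum fun q _ => h2 p q
      _ = (∑ p ∈ S, ∑ q ∈ S, T p q + ∑ p ∈ S, ∑ q ∈ S, T q p) / 2 := by
          simp_rw [← Finset.sum_div, Finset.sum_add_distrib]
      _ = _ := by rw [hsw]; ring
  have h4 : ∑ p ∈ S, ∑ q ∈ S, T p q = ∑ m ∈ Finset.range K, ∑ n' ∈ Finset.range K,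
      (‖a m‖ ^ 2 * ‖b n'‖ ^ 2 / (n' + 1)) * (Real.pi *
        ∑ p ∈ S, hankelGram m p.2 p.1 n' * (p.2 + 1)) := by
    simp_rw [hS, Finset.sum_product, Finset.mul_sum, hT]
    refine Finset.sum_congr rfl fun m _ => ?_
    rw [Finset.sum_comm]
    conv_rhs => rw [Finset.sum_comm]
    exact Finset.sum_congr rfl fun m' _ => Finset.sum_comm
  rw [h4] at h3
  refine h3.trans ?_
  rw [Finset.sum_mul_sum, Finset.mul_sum]
  refine Finset.sum_le_sum fun m _ => ?_
  rw [Finset.mul_sum]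
  refine Finset.sum_le_sum fun n' _ => ?_
  calc _ ≤ (‖a m‖ ^ 2 * ‖b n'‖ ^ 2 / (n' + 1)) * (Real.pi * (m / 2)) := by
        gcongr
        exact sum_hankelGram_mul_le K m n'
    _ = _ := by ring

/-- The square of the `L²`-distance from `F` to the Bergman space of the unit disc. -/
noncomputable def bergmanDistSq (F : ℂ → ℂ) : ℝ :=
  ⨅ g : {g : ℂ → ℂ // DifferentiableOn ℂ g (Metric.ball (0 : ℂ) 1) ∧
      IntegrableOn (fun z => ‖g z‖ ^ 2) (Metric.ball (0 : ℂ) 1) volume},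
    ∫ z in Metric.ball (0 : ℂ) 1, ‖F z - g.1 z‖ ^ 2

theorem bergmanDistSq_le (F : ℂ → ℂ) {g : ℂ → ℂ}
    (hg : DifferentiableOn ℂ g (Metric.ball (0 : ℂ) 1))
    (hg2 : IntegrableOn (fun z => ‖g z‖ ^ 2) (Metric.ball (0 : ℂ) 1) volume) :
    bergmanDistSq F ≤ ∫ z in Metric.ball (0 : ℂ) 1, ‖F z - g z‖ ^ 2 :=
  ciInf_le (f := fun g : {g : ℂ → ℂ // DifferentiableOn ℂ g (Metric.ball (0 : ℂ) 1) ∧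
      IntegrableOn (fun z => ‖g z‖ ^ 2) (Metric.ball (0 : ℂ) 1) volume} =>
      ∫ z in Metric.ball (0 : ℂ) 1, ‖F z - g.1 z‖ ^ 2)
    ⟨0, by rintro _ ⟨g, rfl⟩; positivity⟩ ⟨g, hg, hg2⟩

theorem bergmanDistSq_polynomial_le (K : ℕ) (a b : ℕ → ℂ) :
    bergmanDistSq (fun z => (starRingEnd ℂ) (∑ m ∈ Finset.range (K + 1), a m * z ^ m) *
        ∑ n ∈ Finset.range (K + 1), b n * z ^ n) ≤
      1 / (2 * Real.pi) *
        (∫ z in Metric.ball (0 : ℂ) 1,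
          ‖∑ n ∈ Finset.range K, (((n : ℂ) + 1) * a (n + 1)) * z ^ n‖ ^ 2) *
        ∫ z in Metric.ball (0 : ℂ) 1, ‖∑ n ∈ Finset.range (K + 1), b n * z ^ n‖ ^ 2 := by
  set S := Finset.range (K + 1) ×ˢ Finset.range (K + 1) with hS
  have hgd : Differentiable ℂ fun z : ℂ => ∑ p ∈ S, ((starRingEnd ℂ) (a p.1) * b p.2) *
      (((p.2 + 1 - p.1 : ℕ) : ℂ) / (p.2 + 1) * z ^ (p.2 - p.1)) := by fun_prop
  refine (bergmanDistSq_le _ hgd.differentiableOn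
    (integrableOn_ball_of_continuous (hgd.continuous.norm.pow 2))).trans ?_
  have h1 : ∀ z : ℂ, (starRingEnd ℂ) (∑ m ∈ Finset.range (K + 1), a m * z ^ m) *
        (∑ n ∈ Finset.range (K + 1), b n * z ^ n) -
        ∑ p ∈ S, ((starRingEnd ℂ) (a p.1) * b p.2) *
      (((p.2 + 1 - p.1 : ℕ) : ℂ) / (p.2 + 1) * z ^ (p.2 - p.1)) =
      ∑ p ∈ S, ((starRingEnd ℂ) (a p.1) * b p.2) * hankelMonomial p.1 p.2 z := by
    intro z
    rw [map_sum, Finset.sum_mul_sum, ← Finset.sum_product', ← hS, ← Finset.sum_sub_distrib]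
    refine Finset.sum_congr rfl fun p _ => ?_
    rw [hankelMonomial, map_mul, map_pow]
    ring
  simp_rw [h1]
  refine (integral_ball_hankel_polynomial_le (K + 1) a b).trans (le_of_eq ?_)
  rw [integral_ball_normSq_polynomial, integral_ball_normSq_polynomial]
  have h2 : ∑ m ∈ Finset.range (K + 1), (m : ℝ) * ‖a m‖ ^ 2 =
      ∑ n ∈ Finset.range K, ‖((n : ℂ) + 1) * a (n + 1)‖ ^ 2 / (n + 1) := by
    rw [Finset.sum_range_succ']
    simp only [Nat.cast_zero, zero_mul, add_zero]
    refine Finset.sum_congr rfl fun n _ => ?_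
    have : ‖(n : ℂ) + 1‖ = n + 1 := by
      rw [← Nat.cast_succ, Complex.norm_natCast]
      push_cast
      rfl
    rw [norm_mul, this]
    push_cast
    field_simp
  rw [h2]
  have := Real.pi_pos.ne'
  field_simp

theorem integrableOn_ball_sq_norm {F : ℂ → ℂ}
    (hF : MemLp F 2 (volume.restrict (Metric.ball (0 : ℂ) 1))) :
    IntegrableOn (fun z => ‖F z‖ ^ 2) (Metric.ball (0 : ℂ) 1) :=
  (memLp_two_iff_integrable_sq_norm hF.1).mp hF

theorem bergmanDistSq_le_add {F G : ℂ → ℂ}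
    (hF : MemLp F 2 (volume.restrict (Metric.ball (0 : ℂ) 1)))
    (hG : MemLp G 2 (volume.restrict (Metric.ball (0 : ℂ) 1))) {δ : ℝ} (hδ : 0 < δ) :
    bergmanDistSq F ≤ (1 + δ) * bergmanDistSq G +
      (1 + δ⁻¹) * ∫ z in Metric.ball (0 : ℂ) 1, ‖F z - G z‖ ^ 2 := by
  have : Nonempty {g : ℂ → ℂ // DifferentiableOn ℂ g (Metric.ball (0 : ℂ) 1) ∧
      IntegrableOn (fun z => ‖g z‖ ^ 2) (Metric.ball (0 : ℂ) 1) volume} :=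
    ⟨⟨fun _ => 0, differentiableOn_const _, by simp⟩⟩
  rw [← sub_le_iff_le_add, ← div_le_iff₀' (by positivity)]
  refine le_ciInf fun ⟨g, hg, hg2⟩ => ?_
  rw [div_le_iff₀' (by positivity), sub_le_iff_le_add]
  refine (bergmanDistSq_le F hg hg2).trans ?_
  have hgL : MemLp g 2 (volume.restrict (Metric.ball (0 : ℂ) 1)) :=
    (memLp_two_iff_integrable_sq_norm
      (hg.continuousOn.aestronglyMeasurable measurableSet_ball)).mpr hg2
  rw [← integral_const_mul, ← integral_const_mul, ← integral_add]
  · refine integral_mono (integrableOn_ball_sq_norm (hF.sub hgL)) ?_ fun z => ?_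
    · exact ((integrableOn_ball_sq_norm (hG.sub hgL)).const_mul _).add
        ((integrableOn_ball_sq_norm (hF.sub hG)).const_mul _)
    · have h1 : ‖F z - g z‖ ≤ ‖G z - g z‖ + ‖F z - G z‖ := by
        calc ‖F z - g z‖ = ‖(G z - g z) + (F z - G z)‖ := by congr 1; ring
          _ ≤ _ := norm_add_le _ _
      have h2 : ‖F z - g z‖ ^ 2 ≤ (‖G z - g z‖ + ‖F z - G z‖) ^ 2 := by gcongr
      have h3 : (1 + δ) * ‖G z - g z‖ ^ 2 + (1 + δ⁻¹) * ‖F z - G z‖ ^ 2 -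
          (‖G z - g z‖ + ‖F z - G z‖) ^ 2 = (δ * ‖G z - g z‖ - ‖F z - G z‖) ^ 2 / δ := by
        field_simp
        ring
      have h4 : 0 ≤ (δ * ‖G z - g z‖ - ‖F z - G z‖) ^ 2 / δ := by positivity
      show ‖F z - g z‖ ^ 2 ≤ (1 + δ) * ‖G z - g z‖ ^ 2 + (1 + δ⁻¹) * ‖F z - G z‖ ^ 2
      linarith
  · exact (integrableOn_ball_sq_norm (hG.sub hgL)).const_mul _
  · exact (integrableOn_ball_sq_norm (hF.sub hG)).const_mul _

theorem bergmanDistSq_le_of_tendsto {F : ℂ → ℂ} {G : ℕ → ℂ → ℂ} {C : ℝ} {c : ℕ → ℝ}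
    (hF : MemLp F 2 (volume.restrict (Metric.ball (0 : ℂ) 1)))
    (hG : ∀ k, MemLp (G k) 2 (volume.restrict (Metric.ball (0 : ℂ) 1)))
    (hc : ∀ k, bergmanDistSq (G k) ≤ c k) (hcC : Filter.Tendsto c Filter.atTop (nhds C))
    (hFG : Filter.Tendsto (fun k => ∫ z in Metric.ball (0 : ℂ) 1, ‖F z - G k z‖ ^ 2)
      Filter.atTop (nhds 0)) :
    bergmanDistSq F ≤ C := by
  have h1 : ∀ δ : ℝ, 0 < δ → bergmanDistSq F ≤ (1 + δ) * C := by
    intro δ hδ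
    have hlim := (hcC.const_mul (1 + δ)).add (hFG.const_mul (1 + δ⁻¹))
    rw [mul_zero, add_zero] at hlim
    refine ge_of_tendsto' hlim fun k => ?_
    refine (bergmanDistSq_le_add hF (hG k) hδ).trans ?_
    gcongr
    exact hc k
  have h2 : Filter.Tendsto (fun δ : ℝ => (1 + δ) * C) (nhdsWithin 0 (Set.Ioi 0)) (nhds C) := by
    have : Continuous fun δ : ℝ => (1 + δ) * C := by fun_prop
    simpa using (this.tendsto 0).mono_left nhdsWithin_le_nhds
  exact ge_of_tendsto h2 (by filter_upwards [self_mem_nhdsWithin] with δ hδ using h1 δ hδ)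

theorem tendsto_integral_ball_of_bounded {h : ℕ → ℂ → ℝ} {H : ℂ → ℝ} (M : ℝ)
    (hc : ∀ k, ContinuousOn (h k) (Metric.ball (0 : ℂ) 1))
    (hM : ∀ k, ∀ z ∈ Metric.ball (0 : ℂ) 1, ‖h k z‖ ≤ M)
    (hlim : ∀ z ∈ Metric.ball (0 : ℂ) 1,
      Filter.Tendsto (fun k => h k z) Filter.atTop (nhds (H z))) :
    Filter.Tendsto (fun k => ∫ z in Metric.ball (0 : ℂ) 1, h k z) Filter.atTop
      (nhds (∫ z in Metric.ball (0 : ℂ) 1, H z)) := by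
  have : IsFiniteMeasure (volume.restrict (Metric.ball (0 : ℂ) 1)) :=
    isFiniteMeasure_restrict.mpr measure_ball_lt_top.ne
  refine tendsto_integral_of_dominated_convergence (fun _ => M)
    (fun k => (hc k).aestronglyMeasurable measurableSet_ball) (integrable_const M)
    (fun k => ?_) ?_
  · exact (ae_restrict_iff' measurableSet_ball).mpr (Filter.Eventually.of_forall (hM k))
  · exact (ae_restrict_iff' measurableSet_ball).mpr (Filter.Eventually.of_forall hlim)

theorem norm_partialSum_le {c : ℕ → ℂ} (hc : Summable fun n => ‖c n‖) (k : ℕ) {z : ℂ}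
    (hz : z ∈ Metric.ball (0 : ℂ) 1) :
    ‖∑ n ∈ Finset.range k, c n * z ^ n‖ ≤ ∑' n, ‖c n‖ := by
  have hz1 : ‖z‖ ≤ 1 := (mem_ball_zero_iff.mp hz).le
  calc _ ≤ ∑ n ∈ Finset.range k, ‖c n * z ^ n‖ := norm_sum_le _ _
    _ ≤ ∑ n ∈ Finset.range k, ‖c n‖ := by
        refine Finset.sum_le_sum fun n _ => ?_
        rw [norm_mul, norm_pow]
        exact mul_le_of_le_one_right (norm_nonneg _) (pow_le_one₀ (norm_nonneg _) hz1)
    _ ≤ _ := hc.sum_le_tsum _ fun n _ => norm_nonneg _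

theorem bergmanDistSq_le_of_hasSum {ψ ψ' f : ℂ → ℂ} {a b : ℕ → ℂ}
    (hψc : ContinuousOn ψ (Metric.ball (0 : ℂ) 1)) (hfc : ContinuousOn f (Metric.ball (0 : ℂ) 1))
    (ha : Summable fun n => ‖a n‖) (ha' : Summable fun n : ℕ => ‖((n : ℂ) + 1) * a (n + 1)‖)
    (hb : Summable fun n => ‖b n‖)
    (hψ : ∀ z ∈ Metric.ball (0 : ℂ) 1, HasSum (fun n => a n * z ^ n) (ψ z))
    (hψ' : ∀ z ∈ Metric.ball (0 : ℂ) 1,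
      HasSum (fun n : ℕ => (((n : ℂ) + 1) * a (n + 1)) * z ^ n) (ψ' z))
    (hf : ∀ z ∈ Metric.ball (0 : ℂ) 1, HasSum (fun n => b n * z ^ n) (f z)) :
    bergmanDistSq (fun z => (starRingEnd ℂ) (ψ z) * f z) ≤
      1 / (2 * Real.pi) * (∫ z in Metric.ball (0 : ℂ) 1, ‖ψ' z‖ ^ 2) *
        ∫ z in Metric.ball (0 : ℂ) 1, ‖f z‖ ^ 2 := by
  have hconj := Complex.continuous_conj
  have tψ := fun z hz => ((hψ z hz).tendsto_sum_nat.comp (Filter.tendsto_add_atTop_nat 1))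
  have tψ' := fun z hz => (hψ' z hz).tendsto_sum_nat
  have tf := fun z hz => ((hf z hz).tendsto_sum_nat.comp (Filter.tendsto_add_atTop_nat 1))
  have bψ : ∀ z ∈ Metric.ball (0 : ℂ) 1, ‖ψ z‖ ≤ ∑' n, ‖a n‖ := fun z hz =>
    le_of_tendsto' (tψ z hz).norm fun k => norm_partialSum_le ha _ hz
  have bf : ∀ z ∈ Metric.ball (0 : ℂ) 1, ‖f z‖ ≤ ∑' n, ‖b n‖ := fun z hz =>
    le_of_tendsto' (tf z hz).norm fun k => norm_partialSum_le hb _ hz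
  set A := ∑' n, ‖a n‖
  set B := ∑' n, ‖b n‖
  have hA : 0 ≤ A := tsum_nonneg fun n => norm_nonneg _
  have hFc : ContinuousOn (fun z => (starRingEnd ℂ) (ψ z) * f z) (Metric.ball (0 : ℂ) 1) :=
    (hconj.comp_continuousOn hψc).mul hfc
  have hPc : ∀ k : ℕ, Continuous fun z : ℂ =>
      (starRingEnd ℂ) (∑ m ∈ Finset.range (k + 1), a m * z ^ m) *
        ∑ n ∈ Finset.range (k + 1), b n * z ^ n := fun k => by fun_prop
  refine bergmanDistSq_le_of_tendsto ?_ ?_ (fun k => bergmanDistSq_polynomial_le k a b) ?_ ?_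
  · have : IsFiniteMeasure (volume.restrict (Metric.ball (0 : ℂ) 1)) :=
      isFiniteMeasure_restrict.mpr measure_ball_lt_top.ne
    refine MemLp.of_bound (hFc.aestronglyMeasurable measurableSet_ball) (A * B) ?_
    refine (ae_restrict_iff' measurableSet_ball).mpr (Filter.Eventually.of_forall fun z hz => ?_)
    rw [norm_mul, RCLike.norm_conj]
    exact mul_le_mul (bψ z hz) (bf z hz) (norm_nonneg _) hA
  · exact fun k => (memLp_two_iff_integrable_sq_norm (hPc k).aestronglyMeasurable).mpr
      (integrableOn_ball_of_continuous ((hPc k).norm.pow 2))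
  · refine Filter.Tendsto.mul (Filter.Tendsto.const_mul _ ?_) ?_
    · refine tendsto_integral_ball_of_bounded ((∑' n : ℕ, ‖((n : ℂ) + 1) * a (n + 1)‖) ^ 2)
        (fun k => Continuous.continuousOn (by fun_prop)) (fun k z hz => ?_)
        (fun z hz => (tψ' z hz).norm.pow 2)
      rw [Real.norm_of_nonneg (by positivity)]
      exact pow_le_pow_left₀ (norm_nonneg _) (norm_partialSum_le ha' k hz) 2
    · refine tendsto_integral_ball_of_bounded (B ^ 2)
        (fun k => Continuous.continuousOn (by fun_prop)) (fun k z hz => ?_)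
        (fun z hz => (tf z hz).norm.pow 2)
      rw [Real.norm_of_nonneg (by positivity)]
      exact pow_le_pow_left₀ (norm_nonneg _) (norm_partialSum_le hb _ hz) 2
  · have h0 : (0 : ℝ) = ∫ z in Metric.ball (0 : ℂ) 1, (0 : ℝ) := by simp
    rw [h0]
    refine tendsto_integral_ball_of_bounded ((A * B + A * B) ^ 2)
      (fun k => ((hFc.sub (hPc k).continuousOn).norm.pow 2)) (fun k z hz => ?_) (fun z hz => ?_)
    · rw [Real.norm_of_nonneg (by positivity)]
      refine pow_le_pow_left₀ (norm_nonneg _) ((norm_sub_le _ _).trans ?_) 2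
      rw [norm_mul, norm_mul, RCLike.norm_conj, RCLike.norm_conj]
      exact add_le_add (mul_le_mul (bψ z hz) (bf z hz) (norm_nonneg _) hA)
        (mul_le_mul (norm_partialSum_le ha _ hz) (norm_partialSum_le hb _ hz) (norm_nonneg _) hA)
    · have h1 := (((hconj.tendsto _).comp (tψ z hz)).mul (tf z hz)).const_sub
        ((starRingEnd ℂ) (ψ z) * f z)
      rw [sub_self] at h1
      have h2 := h1.norm.pow 2
      rw [norm_zero, zero_pow two_ne_zero] at h2
      exact h2

theorem hasSum_iteratedDeriv_ball {h : ℂ → ℂ} {R : ℝ}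
    (hh : DifferentiableOn ℂ h (Metric.ball (0 : ℂ) R)) {z : ℂ} (hz : z ∈ Metric.ball (0 : ℂ) R) :
    HasSum (fun n : ℕ => ((n.factorial : ℂ)⁻¹ * iteratedDeriv n h 0) * z ^ n) (h z) := by
  have h1 := Complex.hasSum_taylorSeries_on_ball hh hz
  simp only [sub_zero, smul_eq_mul] at h1
  simpa only [mul_assoc, mul_comm (z ^ _)] using h1

theorem summable_norm_iteratedDeriv {h : ℂ → ℂ} {R : ℝ} (hR : 1 < R)
    (hh : DifferentiableOn ℂ h (Metric.ball (0 : ℂ) R)) :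
    Summable fun n : ℕ => ‖(n.factorial : ℂ)⁻¹ * iteratedDeriv n h 0‖ := by
  have h1 : (1 : ℂ) ∈ Metric.ball (0 : ℂ) R := by simpa using hR
  simpa using (hasSum_iteratedDeriv_ball hh h1).summable.norm

theorem bergmanDistSq_le_of_differentiableOn {ψ f : ℂ → ℂ} {R : ℝ} (hR : 1 < R)
    (hψ : DifferentiableOn ℂ ψ (Metric.ball (0 : ℂ) R))
    (hf : DifferentiableOn ℂ f (Metric.ball (0 : ℂ) R)) :
    bergmanDistSq (fun z => (starRingEnd ℂ) (ψ z) * f z) ≤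
      1 / (2 * Real.pi) * (∫ z in Metric.ball (0 : ℂ) 1, ‖deriv ψ z‖ ^ 2) *
        ∫ z in Metric.ball (0 : ℂ) 1, ‖f z‖ ^ 2 := by
  have hsub : Metric.ball (0 : ℂ) 1 ⊆ Metric.ball (0 : ℂ) R := Metric.ball_subset_ball hR.le
  have hψ' := hψ.deriv Metric.isOpen_ball
  have hcoef : ∀ n : ℕ, (n.factorial : ℂ)⁻¹ * iteratedDeriv n (deriv ψ) 0 =
      ((n : ℂ) + 1) * (((n + 1).factorial : ℂ)⁻¹ * iteratedDeriv (n + 1) ψ 0) := by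
    intro n
    have h1 : (n.factorial : ℂ) ≠ 0 := by exact_mod_cast n.factorial_ne_zero
    have h2 : (n : ℂ) + 1 ≠ 0 := by exact_mod_cast n.succ_ne_zero
    rw [iteratedDeriv_succ', Nat.factorial_succ]
    push_cast
    field_simp
  refine bergmanDistSq_le_of_hasSum (hψ.continuousOn.mono hsub) (hf.continuousOn.mono hsub)
    (summable_norm_iteratedDeriv hR hψ) ?_ (summable_norm_iteratedDeriv hR hf)
    (fun z hz => hasSum_iteratedDeriv_ball hψ (hsub hz)) (fun z hz => ?_)
    (fun z hz => hasSum_iteratedDeriv_ball hf (hsub hz))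
  · simp_rw [← hcoef]
    exact summable_norm_iteratedDeriv hR hψ'
  · simp_rw [← hcoef]
    exact hasSum_iteratedDeriv_ball hψ' (hsub hz)

open scoped Pointwise in
theorem smul_ball_subset {r : ℝ} (hr : 0 < r) (hr1 : r < 1) :
    r • Metric.ball (0 : ℂ) 1 ⊆ Metric.ball (0 : ℂ) 1 := by
  rw [smul_unitBall_of_pos hr]
  exact Metric.ball_subset_ball hr1.le

theorem integral_ball_comp_mul_le {h : ℂ → ℝ} (h0 : ∀ z, 0 ≤ h z)
    (hi : IntegrableOn h (Metric.ball (0 : ℂ) 1)) {r : ℝ} (hr : 0 < r) (hr1 : r < 1) :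
    ∫ z in Metric.ball (0 : ℂ) 1, h (r * z) ≤ (r ^ 2)⁻¹ * ∫ z in Metric.ball (0 : ℂ) 1, h z := by
  have h1 := Measure.setIntegral_comp_smul_of_pos (volume : Measure ℂ) h
    (Metric.ball (0 : ℂ) 1) hr
  simp only [Complex.real_smul, Complex.finrank_real_complex, smul_eq_mul] at h1
  rw [h1]
  refine mul_le_mul_of_nonneg_left ?_ (by positivity)
  exact setIntegral_mono_set hi (Filter.Eventually.of_forall h0)
    (smul_ball_subset hr hr1).eventuallyLE

theorem integrableOn_ball_comp_mul {h : ℂ → ℝ}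
    (hi : IntegrableOn h (Metric.ball (0 : ℂ) 1)) {r : ℝ} (hr : 0 < r) (hr1 : r < 1) :
    IntegrableOn (fun z => h (r * z)) (Metric.ball (0 : ℂ) 1) := by
  rw [← integrable_indicator_iff measurableSet_ball]
  have h1 := (integrable_comp_smul_iff (volume : Measure ℂ)
    ((Metric.ball (0 : ℂ) r).indicator h) hr.ne').mpr
      ((integrable_indicator_iff measurableSet_ball).mpr
        (hi.mono_set (Metric.ball_subset_ball hr1.le)))
  refine h1.congr (Filter.Eventually.of_forall fun z => ?_)
  simp [Set.indicator, abs_of_pos hr, mul_lt_iff_lt_one_right hr]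

/-- Pointwise convergence together with an asymptotic bound on the norms by the norm of the limit
implies convergence in `L²`. -/
theorem tendsto_integral_sq_norm_sub {α E : Type*} [MeasurableSpace α] {μ : Measure α}
    [NormedAddCommGroup E] [InnerProductSpace ℝ E] {F : α → E} {G : ℕ → α → E} {c : ℕ → ℝ}
    (hF : MemLp F 2 μ) (hG : ∀ k, MemLp (G k) 2 μ)
    (hlim : ∀ᵐ x ∂μ, Filter.Tendsto (fun k => G k x) Filter.atTop (nhds (F x)))
    (hGc : ∀ k, ∫ x, ‖G k x‖ ^ 2 ∂μ ≤ c k)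
    (hc : Filter.Tendsto c Filter.atTop (nhds (∫ x, ‖F x‖ ^ 2 ∂μ))) :
    Filter.Tendsto (fun k => ∫ x, ‖F x - G k x‖ ^ 2 ∂μ) Filter.atTop (nhds 0) := by
  have sq : ∀ {H : α → E}, MemLp H 2 μ → Integrable (fun x => ‖H x‖ ^ 2) μ := fun hH =>
    (memLp_two_iff_integrable_sq_norm hH.1).mp hH
  set m : ℕ → α → ℝ := fun k x => min (‖F x + G k x‖ ^ 2) (4 * ‖F x‖ ^ 2) with hm
  have hmi : ∀ k, Integrable (m k) μ := fun k => (sq (hF.add (hG k))).inf ((sq hF).const_mul 4)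
  have hmlim : Filter.Tendsto (fun k => ∫ x, m k x ∂μ) Filter.atTop
      (nhds (∫ x, 4 * ‖F x‖ ^ 2 ∂μ)) := by
    refine tendsto_integral_of_dominated_convergence (fun x => 4 * ‖F x‖ ^ 2)
      (fun k => (hmi k).1) ((sq hF).const_mul 4) (fun k => ?_) ?_
    · refine Filter.Eventually.of_forall fun x => ?_
      rw [Real.norm_of_nonneg (le_min (by positivity) (by positivity))]
      exact min_le_right _ _
    · filter_upwards [hlim] with x hx
      have h1 := ((hx.const_add (F x)).norm.pow 2).min
        (tendsto_const_nhds (x := 4 * ‖F x‖ ^ 2))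
      have h2 : ‖F x + F x‖ ^ 2 = 4 * ‖F x‖ ^ 2 := by
        rw [← two_smul ℝ, norm_smul, mul_pow]
        norm_num
      rwa [h2, min_self] at h1
  rw [integral_const_mul] at hmlim
  have hup := ((hc.const_mul 2).const_add (2 * ∫ x, ‖F x‖ ^ 2 ∂μ)).sub hmlim
  have hz : 2 * (∫ x, ‖F x‖ ^ 2 ∂μ) + 2 * (∫ x, ‖F x‖ ^ 2 ∂μ) - 4 * (∫ x, ‖F x‖ ^ 2 ∂μ) = 0 := by
    ring
  rw [hz] at hup
  refine squeeze_zero (fun k => by positivity) (fun k => ?_) hup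
  have h1 : ∫ x, ‖F x - G k x‖ ^ 2 ∂μ ≤
      ∫ x, (2 * ‖F x‖ ^ 2 + 2 * ‖G k x‖ ^ 2 - m k x) ∂μ := by
    refine integral_mono (sq (hF.sub (hG k)))
      ((((sq hF).const_mul 2).add ((sq (hG k)).const_mul 2)).sub (hmi k)) fun x => ?_
    have hp := parallelogram_law_with_norm ℝ (F x) (G k x)
    have hle : m k x ≤ ‖F x + G k x‖ ^ 2 := min_le_left _ _
    show ‖F x - G k x‖ ^ 2 ≤ 2 * ‖F x‖ ^ 2 + 2 * ‖G k x‖ ^ 2 - m k x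
    linarith
  have h2 := integral_sub (((sq hF).const_mul 2).add ((sq (hG k)).const_mul 2)) (hmi k)
  simp only [Pi.add_apply] at h2
  rw [h2, integral_add ((sq hF).const_mul 2) ((sq (hG k)).const_mul 2), integral_const_mul,
    integral_const_mul] at h1
  linarith [hGc k]

/-- Sharp Hankel estimate on the Bergman space `A²(𝔻)` (case `α = 0`):
the `L²`-distance from `conj(ψ)·f` to the Bergman space is controlled by
`(1/(2π)) ‖ψ'‖² ‖f‖²`. -/
theorem hankel_estimate_bergman_disc
    (ψ f : ℂ → ℂ)
    (hψ : DifferentiableOn ℂ ψ (Metric.ball (0 : ℂ) 1))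
    (hf : DifferentiableOn ℂ f (Metric.ball (0 : ℂ) 1))
    (hf2 : IntegrableOn (fun z => ‖f z‖ ^ 2) (Metric.ball (0 : ℂ) 1) volume)
    (hψ'2 : IntegrableOn (fun z => ‖deriv ψ z‖ ^ 2) (Metric.ball (0 : ℂ) 1) volume)
    (hψf : IntegrableOn (fun z => ‖ψ z‖ ^ 2 * ‖f z‖ ^ 2) (Metric.ball (0 : ℂ) 1) volume) :
    ⨅ g : {g : ℂ → ℂ // DifferentiableOn ℂ g (Metric.ball (0 : ℂ) 1) ∧
        IntegrableOn (fun z => ‖g z‖ ^ 2) (Metric.ball (0 : ℂ) 1) volume},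
      ∫ z in Metric.ball (0 : ℂ) 1, ‖(starRingEnd ℂ) (ψ z) * f z - g.1 z‖ ^ 2 ≤
    (1 / (2 * Real.pi)) * (∫ z in Metric.ball (0 : ℂ) 1, ‖deriv ψ z‖ ^ 2) *
      (∫ z in Metric.ball (0 : ℂ) 1, ‖f z‖ ^ 2) := by
  set F : ℂ → ℂ := fun z => (starRingEnd ℂ) (ψ z) * f z with hFdef
  change bergmanDistSq F ≤ _
  have hFc : ContinuousOn F (Metric.ball (0 : ℂ) 1) :=
    (Complex.continuous_conj.comp_continuousOn hψ.continuousOn).mul hf.continuousOn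
  have hF2 : IntegrableOn (fun z => ‖F z‖ ^ 2) (Metric.ball (0 : ℂ) 1) := by
    simpa only [hFdef, norm_mul, RCLike.norm_conj, mul_pow] using hψf
  have hF : MemLp F 2 (volume.restrict (Metric.ball (0 : ℂ) 1)) :=
    (memLp_two_iff_integrable_sq_norm (hFc.aestronglyMeasurable measurableSet_ball)).mpr hF2
  set r : ℕ → ℝ := fun k => 1 - 1 / ((k : ℝ) + 2) with hr
  have hr0 : ∀ k, 0 < r k := by
    intro k
    have : 1 / ((k : ℝ) + 2) < 1 := by
      rw [div_lt_one (by positivity)]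
      linarith [(k.cast_nonneg : (0 : ℝ) ≤ k)]
    simp only [hr]
    linarith
  have hr1 : ∀ k, r k < 1 := by
    intro k
    have : 0 < 1 / ((k : ℝ) + 2) := by positivity
    simp only [hr]
    linarith
  have hrlim : Filter.Tendsto r Filter.atTop (nhds 1) := by
    have h1 : Filter.Tendsto (fun k : ℕ => 1 / ((k : ℝ) + 2)) Filter.atTop (nhds 0) :=
      tendsto_const_nhds.div_atTop
        (Filter.tendsto_atTop_add_const_right _ _ tendsto_natCast_atTop_atTop)
    simpa only [sub_zero] using h1.const_sub 1
  have hrinv : Filter.Tendsto (fun k => (r k ^ 2)⁻¹) Filter.atTop (nhds 1) := by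
    simpa using (hrlim.pow 2).inv₀ (by norm_num)
  have hmaps : ∀ k, Set.MapsTo (fun z : ℂ => (r k : ℂ) * z) (Metric.ball (0 : ℂ) (r k)⁻¹)
      (Metric.ball (0 : ℂ) 1) := by
    intro k z hz
    rw [mem_ball_zero_iff] at hz ⊢
    rw [norm_mul, Complex.norm_real, Real.norm_of_nonneg (hr0 k).le]
    calc r k * ‖z‖ < r k * (r k)⁻¹ := mul_lt_mul_of_pos_left hz (hr0 k)
      _ = 1 := mul_inv_cancel₀ (hr0 k).ne'
  have hR : ∀ k, 1 < (r k)⁻¹ := fun k => (one_lt_inv₀ (hr0 k)).mpr (hr1 k)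
  have hmaps1 : ∀ k, Set.MapsTo (fun z : ℂ => (r k : ℂ) * z) (Metric.ball (0 : ℂ) 1)
      (Metric.ball (0 : ℂ) 1) := fun k =>
    (hmaps k).mono_left (Metric.ball_subset_ball (hR k).le)
  have hG : ∀ k, MemLp (fun z => F (r k * z)) 2 (volume.restrict (Metric.ball (0 : ℂ) 1)) := by
    intro k
    have hcont : ContinuousOn (fun z => F (r k * z)) (Metric.ball (0 : ℂ) 1) :=
      hFc.comp (by fun_prop) (hmaps1 k)
    exact (memLp_two_iff_integrable_sq_norm
      (hcont.aestronglyMeasurable measurableSet_ball)).mpr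
        (integrableOn_ball_comp_mul hF2 (hr0 k) (hr1 k))
  set P := ∫ z in Metric.ball (0 : ℂ) 1, ‖deriv ψ z‖ ^ 2
  set Q := ∫ z in Metric.ball (0 : ℂ) 1, ‖f z‖ ^ 2
  have hbound : ∀ k, bergmanDistSq (fun z => F (r k * z)) ≤
      1 / (2 * Real.pi) * P * ((r k ^ 2)⁻¹ * Q) := by
    intro k
    have hd : DifferentiableOn ℂ (fun z : ℂ => (r k : ℂ) * z) (Metric.ball (0 : ℂ) (r k)⁻¹) := by
      fun_prop
    have h1 := bergmanDistSq_le_of_differentiableOn (hR k) (hψ.comp hd (hmaps k))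
      (hf.comp hd (hmaps k))
    refine h1.trans ?_
    have hP : ∫ z in Metric.ball (0 : ℂ) 1,
        ‖deriv (ψ ∘ fun z : ℂ => (r k : ℂ) * z) z‖ ^ 2 ≤ P := by
      have h2 : ∀ z, ‖deriv (ψ ∘ fun z : ℂ => (r k : ℂ) * z) z‖ ^ 2 =
          r k ^ 2 * ‖deriv ψ (r k * z)‖ ^ 2 := by
        intro z
        rw [Function.comp_def, deriv_comp_mul_left, smul_eq_mul, norm_mul, Complex.norm_real,
          Real.norm_of_nonneg (hr0 k).le, mul_pow]
      simp_rw [h2]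
      rw [integral_const_mul]
      have h3 := integral_ball_comp_mul_le (fun z => by positivity) hψ'2 (hr0 k) (hr1 k)
      calc _ ≤ r k ^ 2 * ((r k ^ 2)⁻¹ * P) := by gcongr
        _ = P := mul_inv_cancel_left₀ (pow_ne_zero 2 (hr0 k).ne') P
    have hQ := integral_ball_comp_mul_le (fun z => by positivity) hf2 (hr0 k) (hr1 k)
    have hπ := Real.pi_pos
    exact mul_le_mul (mul_le_mul_of_nonneg_left hP (by positivity)) hQ (by positivity)
      (by positivity)
  refine bergmanDistSq_le_of_tendsto hF hG hbound ?_ ?_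
  · simpa using (hrinv.mul_const Q).const_mul (1 / (2 * Real.pi) * P)
  · refine tendsto_integral_sq_norm_sub hF hG ?_
      (fun k => integral_ball_comp_mul_le (fun z => by positivity) hF2 (hr0 k) (hr1 k)) ?_
    · refine (ae_restrict_iff' measurableSet_ball).mpr (Filter.Eventually.of_forall fun z hz => ?_)
      have h1 : Filter.Tendsto (fun k => (r k : ℂ) * z) Filter.atTop (nhds z) := by
        simpa using ((Complex.continuous_ofReal.tendsto 1).comp hrlim).mul_const z
      exact (hFc.continuousAt (Metric.isOpen_ball.mem_nhds hz)).tendsto.comp h1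
    · simpa using hrinv.mul_const (∫ z in Metric.ball (0 : ℂ) 1, ‖F z‖ ^ 2)
end

section
/- Let α > −1 be real and let W_α(z) = (1+α)(1−|z|²)^α for z ∈ 𝔻. Let ψ and f be holomorphic functions on 𝔻 such that ∫_𝔻 |f(z)|² W_α(z) dxdy < ∞, ∫_𝔻 |ψ'(z)|² dxdy < ∞, and ∫_𝔻 |ψ(z)|²|f(z)|² W_α(z) dxdy < ∞. Then the infimum, over all holomorphic functions g on 𝔻 with ∫_𝔻 |g|² W_α dxdy < ∞, of ∫_𝔻 |conj(ψ(z))·f(z) − g(z)|² W_α(z) dxdy is at most (1/((2+α)π)) · (∫_𝔻 |ψ'(z)|² dxdy) · (∫_𝔻 |f(z)|² W_α(z) dxdy). (This is the main theorem for the weighted Bergman space A²_α(𝔻): ‖H_{conj ψ}‖_{A²_α(𝔻)→L²_α(𝔻)} ≤ ‖ψ'‖_{A²(𝔻)}/√(2+α).) -/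
open MeasureTheory Complex

namespace HankelBergman

section Moments

variable {α : ℝ} {c : ℕ → ℝ}

lemma mul_le_mul_of_rec (hα : -1 < α) (hc : ∀ n, 0 < c n)
    (hrec : ∀ n : ℕ, c (n + 1) * (n + α + 2) = (n + 1) * c n) (m k l : ℕ) :
    c (m + k) * c (m + l) ≤ c m * c (m + k + l) := by
  induction l with
  | zero => simp [mul_comm]
  | succ l ih =>
    have h1 := hrec (m + l)
    have h2 := hrec (m + k + l)
    push_cast at h1 h2
    have p1 : (0 : ℝ) < (m + l : ℝ) + α + 2 := by
      have : (0 : ℝ) ≤ (m : ℝ) + l := by positivity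
      linarith
    have p2 : (0 : ℝ) < (m + k + l : ℝ) + α + 2 := by
      have : (0 : ℝ) ≤ (m : ℝ) + k + l := by positivity
      linarith
    have e1 : c (m + (l + 1)) = ((m + l : ℝ) + 1) / ((m + l : ℝ) + α + 2) * c (m + l) := by
      rw [← add_assoc]; field_simp; linarith
    have e2 : c (m + k + (l + 1)) =
        ((m + k + l : ℝ) + 1) / ((m + k + l : ℝ) + α + 2) * c (m + k + l) := by
      rw [← add_assoc]; field_simp; linarith
    rw [e1, e2]
    have q : ((m + l : ℝ) + 1) / ((m + l : ℝ) + α + 2) ≤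
        ((m + k + l : ℝ) + 1) / ((m + k + l : ℝ) + α + 2) := by
      rw [div_le_div_iff₀ p1 p2]
      have : 0 ≤ (k : ℝ) * (α + 1) := mul_nonneg (by positivity) (by linarith)
      nlinarith
    calc _ = ((m + l : ℝ) + 1) / ((m + l : ℝ) + α + 2) * (c (m + k) * c (m + l)) := by ring
      _ ≤ ((m + k + l : ℝ) + 1) / ((m + k + l : ℝ) + α + 2) * (c m * c (m + k + l)) :=
        mul_le_mul q ih (mul_pos (hc _) (hc _)).le (by positivity)
      _ = _ := by ring

lemma mul_sum_inv_of_rec (hα : -1 < α) (hc : ∀ n, 0 < c n)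
    (hrec : ∀ n : ℕ, c (n + 1) * (n + α + 2) = (n + 1) * c n) (n : ℕ) :
    c n * ∑ j ∈ Finset.range (n + 1), (c j)⁻¹ = n / (2 + α) + 1 := by
  have hα2 : 2 + α ≠ 0 := by linarith
  induction n with
  | zero => simp [(hc 0).ne']
  | succ n ih =>
    rw [Finset.sum_range_succ, mul_add, mul_inv_cancel₀ (hc _).ne']
    have p : (n : ℝ) + α + 2 ≠ 0 := by
      have : (0 : ℝ) ≤ (n : ℝ) := by positivity
      linarith
    have e : c (n + 1) = ((n : ℝ) + 1) / (n + α + 2) * c n := by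
      field_simp; linarith [hrec n]
    rw [e, mul_assoc, ih]
    push_cast
    field_simp
    ring

/-- The Gram-type kernel of the Hankel form on homogeneous terms of degree `N`. -/
noncomputable def hankelKernel (c : ℕ → ℝ) (N k l : ℕ) : ℝ :=
  c N - if k + l ≤ N then c (N - k) * c (N - l) / c (N - (k + l)) else 0

lemma hankelKernel_comm (N k l : ℕ) : hankelKernel c N k l = hankelKernel c N l k := by
  simp [hankelKernel, add_comm, mul_comm]

lemma hankelKernel_nonneg (hα : -1 < α) (hc : ∀ n, 0 < c n)
    (hrec : ∀ n : ℕ, c (n + 1) * (n + α + 2) = (n + 1) * c n) (N k l : ℕ) :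
    0 ≤ hankelKernel c N k l := by
  unfold hankelKernel
  split_ifs with h
  · obtain ⟨m, rfl⟩ := Nat.exists_eq_add_of_le h
    have e1 : k + l + m - k = m + l := by omega
    have e2 : k + l + m - l = m + k := by omega
    have e3 : k + l + m - (k + l) = m := by omega
    have e4 : k + l + m = m + k + l := by omega
    rw [e1, e2, e3, e4, sub_nonneg, div_le_iff₀ (hc m)]
    linarith [mul_le_mul_of_rec hα hc hrec m k l]
  · simpa using (hc N).le

lemma sum_hankelKernel_div (hα : -1 < α) (hc : ∀ n, 0 < c n)
    (hrec : ∀ n : ℕ, c (n + 1) * (n + α + 2) = (n + 1) * c n) {N k : ℕ} (hk : k ≤ N) :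
    ∑ l ∈ Finset.range (N + 1), hankelKernel c N k l / c (N - l) = k / (2 + α) := by
  have h1 : ∑ l ∈ Finset.range (N + 1), (c (N - l))⁻¹ = ∑ j ∈ Finset.range (N + 1), (c j)⁻¹ := by
    simpa using Finset.sum_range_reflect (fun j => (c j)⁻¹) (N + 1)
  have h2 : ∑ l ∈ Finset.range (N + 1), (if k + l ≤ N then (c (N - (k + l)))⁻¹ else 0)
      = ∑ j ∈ Finset.range (N - k + 1), (c j)⁻¹ := by
    rw [← Finset.sum_filter]
    have : Finset.filter (fun l => k + l ≤ N) (Finset.range (N + 1))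
        = Finset.range (N - k + 1) := by
      ext l; simp only [Finset.mem_filter, Finset.mem_range]; omega
    rw [this, ← Finset.sum_range_reflect (fun j => (c j)⁻¹) (N - k + 1)]
    refine Finset.sum_congr rfl fun l _ => ?_
    congr 2; omega
  have h3 : ∀ l, hankelKernel c N k l / c (N - l) = c N * (c (N - l))⁻¹
      - c (N - k) * (if k + l ≤ N then (c (N - (k + l)))⁻¹ else 0) := by
    intro l
    have := (hc (N - l)).ne'
    unfold hankelKernel
    split_ifs
    · have := (hc (N - (k + l))).ne'
      field_simp
    · simp [div_eq_mul_inv]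
  rw [Finset.sum_congr rfl fun l _ => h3 l, Finset.sum_sub_distrib, ← Finset.mul_sum,
    ← Finset.mul_sum, h1, h2, mul_sum_inv_of_rec hα hc hrec, mul_sum_inv_of_rec hα hc hrec,
    Nat.cast_sub hk]
  ring

lemma sum_hankelKernel_mul_le (hα : -1 < α) (hc : ∀ n, 0 < c n)
    (hrec : ∀ n : ℕ, c (n + 1) * (n + α + 2) = (n + 1) * c n) (N L : ℕ) (y : ℕ → ℝ)
    (hy : ∀ k, N < k → y k = 0) :
    ∑ k ∈ Finset.range L, ∑ l ∈ Finset.range L, hankelKernel c N k l * (y k * y l) ≤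
      1 / (2 + α) * ∑ k ∈ Finset.range L, k * (y k ^ 2 * c (N - k)) := by
  set S := (Finset.range L).filter (· ≤ N) with hS
  have hsub : S ⊆ Finset.range (N + 1) := by
    intro k hk
    simp only [hS, Finset.mem_filter, Finset.mem_range] at hk ⊢
    omega
  have hSle : ∀ k ∈ S, k ≤ N := fun k hk => (Finset.mem_filter.1 hk).2
  have hred : ∀ F : ℕ → ℝ, (∀ k, y k = 0 → F k = 0) →
      ∑ k ∈ Finset.range L, F k = ∑ k ∈ S, F k := by
    intro F hF
    rw [hS, Finset.sum_filter]
    refine Finset.sum_congr rfl fun k _ => ?_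
    split_ifs with h
    · rfl
    · exact hF k (hy k (by omega))
  rw [hred _ fun k hk => by simp [hk], hred _ fun k hk => by simp [hk]]
  have hin : ∀ k, ∑ l ∈ Finset.range L, hankelKernel c N k l * (y k * y l)
      = ∑ l ∈ S, hankelKernel c N k l * (y k * y l) := fun k => hred _ fun l hl => by simp [hl]
  simp_rw [hin]
  have amgm : ∀ k l, hankelKernel c N k l * (y k * y l) ≤
      1 / 2 * (y k ^ 2 * c (N - k) * (hankelKernel c N k l / c (N - l))) +
      1 / 2 * (y l ^ 2 * c (N - l) * (hankelKernel c N l k / c (N - k))) := by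
    intro k l
    rw [hankelKernel_comm N l k]
    have hk := hc (N - k)
    have hl := hc (N - l)
    have h0 := hankelKernel_nonneg hα hc hrec N k l
    have key : y k * y l ≤ 1 / 2 * (y k ^ 2 * c (N - k) / c (N - l)) +
        1 / 2 * (y l ^ 2 * c (N - l) / c (N - k)) := by
      have : 1 / 2 * (y k ^ 2 * c (N - k) / c (N - l)) +
        1 / 2 * (y l ^ 2 * c (N - l) / c (N - k)) - y k * y l =
        (y k * c (N - k) - y l * c (N - l)) ^ 2 / (2 * (c (N - k) * c (N - l))) := by
        field_simp; ring
      have h : 0 ≤ (y k * c (N - k) - y l * c (N - l)) ^ 2 / (2 * (c (N - k) * c (N - l))) := by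
        positivity
      linarith
    calc _ ≤ _ := mul_le_mul_of_nonneg_left key h0
      _ = _ := by ring
  have hrow : ∀ k ∈ S, ∑ l ∈ S, y k ^ 2 * c (N - k) * (hankelKernel c N k l / c (N - l)) ≤
      1 / (2 + α) * (k * (y k ^ 2 * c (N - k))) := by
    intro k hk
    rw [← Finset.mul_sum]
    calc _ ≤ y k ^ 2 * c (N - k) *
          ∑ l ∈ Finset.range (N + 1), hankelKernel c N k l / c (N - l) := by
          refine mul_le_mul_of_nonneg_left ?_ (mul_nonneg (sq_nonneg _) (hc _).le)
          exact Finset.sum_le_sum_of_subset_of_nonneg hsub fun l _ _ =>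
            div_nonneg (hankelKernel_nonneg hα hc hrec N k l) (hc _).le
      _ = _ := by rw [sum_hankelKernel_div hα hc hrec (hSle k hk)]; ring
  calc _ ≤ ∑ k ∈ S, ∑ l ∈ S,
        (1 / 2 * (y k ^ 2 * c (N - k) * (hankelKernel c N k l / c (N - l))) +
        1 / 2 * (y l ^ 2 * c (N - l) * (hankelKernel c N l k / c (N - k)))) :=
        Finset.sum_le_sum fun k _ => Finset.sum_le_sum fun l _ => amgm k l
    _ = ∑ k ∈ S, ∑ l ∈ S, y k ^ 2 * c (N - k) * (hankelKernel c N k l / c (N - l)) := by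
        simp_rw [Finset.sum_add_distrib]
        rw [Finset.sum_comm (f := fun k l =>
          1 / 2 * (y l ^ 2 * c (N - l) * (hankelKernel c N l k / c (N - k))))]
        simp_rw [← Finset.mul_sum]
        ring
    _ ≤ ∑ k ∈ S, 1 / (2 + α) * (k * (y k ^ 2 * c (N - k))) := Finset.sum_le_sum hrow
    _ = _ := by rw [Finset.mul_sum]

end Moments

section Measure

/-- The disc weight `(1 + α)(1 - r²)^α`, extended by zero outside `r < 1`. -/
noncomputable def discWeight (α r : ℝ) : ℝ :=
  if r < 1 then (1 + α) * (1 - r ^ 2) ^ α else 0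

/-- The weighted area measure `W_α dxdy` on the unit disc. -/
noncomputable def discMeasure (α : ℝ) : Measure ℂ :=
  volume.withDensity fun z => ENNReal.ofReal (discWeight α ‖z‖)

variable {α : ℝ}

lemma discWeight_nonneg (hα : -1 < α) {r : ℝ} (hr : 0 ≤ r) : 0 ≤ discWeight α r := by
  unfold discWeight
  split_ifs with h
  · exact mul_nonneg (by linarith) (Real.rpow_nonneg (by nlinarith) _)
  · exact le_rfl

lemma measurable_discWeight : Measurable fun z : ℂ => discWeight α ‖z‖ := by
  unfold discWeight
  refine Measurable.ite (measurableSet_lt (by fun_prop) (by fun_prop)) ?_ (by fun_prop)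
  fun_prop

lemma ae_norm_lt_one : ∀ᵐ z ∂discMeasure α, ‖z‖ < 1 := by
  rw [discMeasure, ae_withDensity_iff measurable_discWeight.ennreal_ofReal]
  refine Filter.Eventually.of_forall fun z hz => ?_
  by_contra h
  simp [discWeight, h] at hz

lemma integral_discMeasure {E : Type*} [NormedAddCommGroup E] [NormedSpace ℝ E] (hα : -1 < α)
    (h : ℂ → E) : ∫ z, h z ∂discMeasure α = ∫ z, discWeight α ‖z‖ • h z := by
  rw [discMeasure, integral_withDensity_eq_integral_toReal_smul
    measurable_discWeight.ennreal_ofReal (by simp)]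
  simp_rw [ENNReal.toReal_ofReal (discWeight_nonneg hα (norm_nonneg _))]

lemma integrable_discMeasure_iff (hα : -1 < α) (h : ℂ → ℝ) :
    Integrable h (discMeasure α) ↔
      IntegrableOn (fun z => h z * ((1 + α) * (1 - ‖z‖ ^ 2) ^ α)) (Metric.ball 0 1) := by
  rw [discMeasure, integrable_withDensity_iff_integrable_smul'
    measurable_discWeight.ennreal_ofReal (by simp), ← integrable_indicator_iff measurableSet_ball]
  simp_rw [ENNReal.toReal_ofReal (discWeight_nonneg hα (norm_nonneg _))]
  refine integrable_congr (Filter.Eventually.of_forall fun z => ?_)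
  by_cases hz : ‖z‖ < 1 <;> simp [discWeight, hz, mul_comm]

lemma integral_discMeasure_eq (hα : -1 < α) (h : ℂ → ℝ) :
    ∫ z, h z ∂discMeasure α =
      ∫ z in Metric.ball 0 1, h z * ((1 + α) * (1 - ‖z‖ ^ 2) ^ α) := by
  rw [integral_discMeasure hα, ← integral_indicator measurableSet_ball]
  refine integral_congr_ae (Filter.Eventually.of_forall fun z => ?_)
  by_cases hz : ‖z‖ < 1 <;> simp [discWeight, hz, mul_comm]

/-- The moment `∫ |z|^{2n} W_α dxdy`. -/
noncomputable def discMoment (α : ℝ) (n : ℕ) : ℝ := ∫ z, ‖z‖ ^ (2 * n) ∂discMeasure α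

lemma discMoment_eq (hα : -1 < α) (n : ℕ) :
    discMoment α n =
      Real.pi * (Real.Gamma (n + 1) * Real.Gamma (α + 2) / Real.Gamma (n + α + 2)) := by
  have h1 : discMoment α n = ∫ z : ℂ, (fun r => discWeight α r * r ^ (2 * n)) ‖z‖ := by
    rw [discMoment, integral_discMeasure hα]; rfl
  have h2 := integral_comp_rpow_Ioi
    (fun t : ℝ => if t < 1 then t ^ n * (1 - t) ^ α else 0) (p := 2) two_ne_zero
  have h3 : ∫ t in Set.Ioi (0 : ℝ), (if t < 1 then t ^ n * (1 - t) ^ α else 0)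
      = ProbabilityTheory.beta (n + 1) (α + 1) := by
    rw [ProbabilityTheory.beta_eq_betaIntegralReal _ _ (by positivity) (by linarith),
      Complex.betaIntegral, intervalIntegral.integral_of_le zero_le_one]
    have : ∀ t : ℝ, (if t < 1 then t ^ n * (1 - t) ^ α else 0)
        = (Set.Iio (1 : ℝ)).indicator (fun t => t ^ n * (1 - t) ^ α) t := by
      intro t; simp [Set.indicator]
    simp_rw [this]
    rw [setIntegral_indicator measurableSet_Iio, Set.Ioi_inter_Iio,
      ← integral_Ioc_eq_integral_Ioo]
    rw [← Complex.ofReal_re (∫ t in Set.Ioc (0 : ℝ) 1, t ^ n * (1 - t) ^ α),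
      ← integral_complex_ofReal]
    congr 1
    refine setIntegral_congr_fun measurableSet_Ioc fun t ht => ?_
    simp only [Complex.ofReal_mul, Complex.ofReal_pow,
      Complex.ofReal_cpow (sub_nonneg.2 ht.2)]
    push_cast
    rw [add_sub_cancel_right, add_sub_cancel_right, Complex.cpow_natCast]
  rw [h3] at h2
  rw [h1, integral_fun_norm_addHaar volume (fun r => discWeight α r * r ^ (2 * n))]
  have h4 : ∫ y in Set.Ioi (0 : ℝ), y ^ (Module.finrank ℝ ℂ - 1) • (discWeight α y * y ^ (2 * n))
      = (1 + α) / 2 * ProbabilityTheory.beta (n + 1) (α + 1) := by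
    rw [← h2, ← integral_const_mul]
    refine setIntegral_congr_fun measurableSet_Ioi fun y hy => ?_
    have hy0 : (0 : ℝ) < y := hy
    have : y ^ (2 : ℝ) < 1 ↔ y < 1 := by
      rw [Real.rpow_two]; constructor <;> intro h <;> nlinarith
    have e : (2 : ℝ) - 1 = 1 := by norm_num
    simp only [Complex.finrank_real_complex, this, discWeight, smul_eq_mul, e, Real.rpow_one]
    split_ifs
    · rw [Real.rpow_two]; norm_num; ring
    · simp
  rw [h4]
  simp only [Complex.finrank_real_complex, Measure.real, Complex.volume_ball]
  rw [ProbabilityTheory.beta, show α + 2 = (α + 1) + 1 by ring,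
    Real.Gamma_add_one (show α + 1 ≠ 0 by linarith),
    show (n : ℝ) + 1 + (α + 1) = n + α + 2 by ring]
  simp
  ring

lemma discMoment_pos (hα : -1 < α) (n : ℕ) : 0 < discMoment α n := by
  rw [discMoment_eq hα]
  have hn : (0 : ℝ) ≤ n := n.cast_nonneg
  have h1 := Real.Gamma_pos_of_pos (show (0 : ℝ) < n + 1 by linarith)
  have h2 := Real.Gamma_pos_of_pos (show (0 : ℝ) < α + 2 by linarith)
  have h3 := Real.Gamma_pos_of_pos (show (0 : ℝ) < n + α + 2 by linarith)
  have := Real.pi_pos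
  positivity

lemma discMoment_succ (hα : -1 < α) (n : ℕ) :
    discMoment α (n + 1) * (n + α + 2) = (n + 1) * discMoment α n := by
  rw [discMoment_eq hα, discMoment_eq hα]
  have hn : (0 : ℝ) ≤ n := n.cast_nonneg
  have h3 := (Real.Gamma_pos_of_pos (show (0 : ℝ) < n + α + 2 by linarith)).ne'
  have h4 : (n : ℝ) + α + 2 ≠ 0 := by linarith
  push_cast
  rw [Real.Gamma_add_one (show (n : ℝ) + 1 ≠ 0 by linarith),
    show (n : ℝ) + 1 + α + 2 = (n + α + 2) + 1 by ring, Real.Gamma_add_one h4]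
  field_simp

lemma discMoment_zero_left (n : ℕ) : discMoment 0 n = Real.pi / (n + 1) := by
  rw [discMoment_eq (by norm_num)]
  have hn : (0 : ℝ) ≤ n := n.cast_nonneg
  have h3 := (Real.Gamma_pos_of_pos (show (0 : ℝ) < n + 1 by linarith)).ne'
  rw [show (n : ℝ) + 0 + 2 = (n + 1) + 1 by ring,
    Real.Gamma_add_one (show (n : ℝ) + 1 ≠ 0 by linarith), zero_add, Real.Gamma_two]
  field_simp

lemma isFiniteMeasure_discMeasure (hα : -1 < α) : IsFiniteMeasure (discMeasure α) := by
  have h := discMoment_pos hα 0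
  have hi : Integrable (fun _ : ℂ => (1 : ℝ)) (discMeasure α) := by
    by_contra hni
    simp only [discMoment, mul_zero, pow_zero, integral_undef hni, lt_irrefl] at h
  exact (integrable_const_iff_isFiniteMeasure one_ne_zero).1 hi

lemma measurePreserving_rotation_discMeasure (u : Circle) :
    MeasurePreserving (rotation u) (discMeasure α) (discMeasure α) := by
  have hv : MeasurePreserving (rotation u) volume volume :=
    (rotation u).measurePreserving
  refine ⟨hv.measurable, ?_⟩
  ext s hs
  rw [Measure.map_apply hv.measurable hs, discMeasure,
    withDensity_apply _ (hv.measurable hs), withDensity_apply _ hs,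
    ← hv.setLIntegral_comp_preimage hs measurable_discWeight.ennreal_ofReal]
  simp only [LinearIsometryEquiv.norm_map]

end Measure

section RotationInvariant

open ComplexConjugate

variable {ν : Measure ℂ}

lemma integrable_of_continuous_of_ae_norm_lt_one {E : Type*} [NormedAddCommGroup E]
    [IsFiniteMeasure ν] (hν : ∀ᵐ z ∂ν, ‖z‖ < 1) {h : ℂ → E} (hh : Continuous h) :
    Integrable h ν := by
  obtain ⟨C, hC⟩ := (isCompact_closedBall (0 : ℂ) 1).exists_bound_of_continuousOn
    hh.continuousOn
  refine Integrable.of_bound hh.aestronglyMeasurable C ?_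
  filter_upwards [hν] with z hz
  exact hC z (by simpa using hz.le)

lemma integral_pow_mul_conj_pow_eq_zero
    (hrot : ∀ u : Circle, MeasurePreserving (rotation u) ν ν) {i j : ℕ} (hij : i ≠ j) :
    ∫ z, z ^ i * conj z ^ j ∂ν = 0 := by
  set θ : ℝ := Real.pi / ((i : ℝ) - j) with hθ
  have hd : (i : ℝ) - j ≠ 0 := sub_ne_zero.2 (by exact_mod_cast hij)
  have hu : ((Circle.exp θ : Circle) : ℂ) ^ i * conj ((Circle.exp θ : Circle) : ℂ) ^ j = -1 := by
    rw [Circle.coe_exp, ← Complex.exp_conj, ← Complex.exp_nat_mul, ← Complex.exp_nat_mul,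
      ← Complex.exp_add, ← Complex.exp_pi_mul_I]
    congr 1
    have : ((i : ℂ) - j) * θ = Real.pi := by
      rw [hθ]; push_cast
      have : (i : ℂ) - j ≠ 0 := by exact_mod_cast hd
      field_simp
    simp only [map_mul, Complex.conj_ofReal, Complex.conj_I]
    linear_combination Complex.I * this
  have h := (hrot (Circle.exp θ)).integral_comp
    (rotation (Circle.exp θ)).toHomeomorph.measurableEmbedding (fun z => z ^ i * conj z ^ j)
  have h2 : ∀ z : ℂ, rotation (Circle.exp θ) z ^ i * conj (rotation (Circle.exp θ) z) ^ j
      = -(z ^ i * conj z ^ j) := by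
    intro z
    rw [rotation_apply, map_mul, mul_pow, mul_pow]
    linear_combination (z ^ i * conj z ^ j) * hu
  simp_rw [h2, integral_neg] at h
  exact self_eq_neg.1 h.symm

lemma integral_pow_mul_conj_pow_self (i : ℕ) :
    ∫ z, z ^ i * conj z ^ i ∂ν = ((∫ z, ‖z‖ ^ (2 * i) ∂ν : ℝ) : ℂ) := by
  rw [← integral_complex_ofReal]
  refine integral_congr_ae (Filter.Eventually.of_forall fun z => ?_)
  simp only
  rw [← mul_pow, Complex.mul_conj, Complex.normSq_eq_norm_sq, pow_mul]
  push_cast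
  rfl

lemma integral_sum_mul_conj_sum [IsFiniteMeasure ν] (hν : ∀ᵐ z ∂ν, ‖z‖ < 1)
    (hrot : ∀ u : Circle, MeasurePreserving (rotation u) ν ν) (a b : ℕ → ℂ) (L : ℕ) :
    ∫ z, (∑ i ∈ Finset.range L, a i * z ^ i) * conj (∑ i ∈ Finset.range L, b i * z ^ i) ∂ν =
      ∑ i ∈ Finset.range L, a i * conj (b i) * ((∫ z, ‖z‖ ^ (2 * i) ∂ν : ℝ) : ℂ) := by
  have hexp : ∀ z : ℂ, (∑ i ∈ Finset.range L, a i * z ^ i) *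
      conj (∑ i ∈ Finset.range L, b i * z ^ i) =
      ∑ i ∈ Finset.range L, ∑ j ∈ Finset.range L,
        (a i * conj (b j)) * (z ^ i * conj z ^ j) := by
    intro z
    rw [map_sum, Finset.sum_mul_sum]
    refine Finset.sum_congr rfl fun i _ => Finset.sum_congr rfl fun j _ => ?_
    simp only [map_mul, map_pow]
    ring
  have hint : ∀ i j : ℕ, Integrable (fun z : ℂ => (a i * conj (b j)) * (z ^ i * conj z ^ j)) ν :=
    fun i j => integrable_of_continuous_of_ae_norm_lt_one hν (by fun_prop)
  simp_rw [hexp]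
  rw [integral_finsetSum _ fun i _ => integrable_finsetSum _ fun j _ => hint i j]
  refine Finset.sum_congr rfl fun i hi => ?_
  rw [integral_finsetSum _ fun j _ => hint i j, Finset.sum_eq_single_of_mem i hi]
  · rw [integral_const_mul, integral_pow_mul_conj_pow_self]
  · intro j _ hj
    rw [integral_const_mul, integral_pow_mul_conj_pow_eq_zero hrot hj.symm, mul_zero]

lemma integral_norm_sum_sq [IsFiniteMeasure ν] (hν : ∀ᵐ z ∂ν, ‖z‖ < 1)
    (hrot : ∀ u : Circle, MeasurePreserving (rotation u) ν ν) (a : ℕ → ℂ) (L : ℕ) :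
    ∫ z, ‖∑ i ∈ Finset.range L, a i * z ^ i‖ ^ 2 ∂ν =
      ∑ i ∈ Finset.range L, ‖a i‖ ^ 2 * ∫ z, ‖z‖ ^ (2 * i) ∂ν := by
  have h := integral_sum_mul_conj_sum hν hrot a a L
  simp_rw [Complex.mul_conj, Complex.normSq_eq_norm_sq] at h
  rw [integral_complex_ofReal] at h
  exact_mod_cast h

lemma measurePreserving_rotation_restrict_closedBall
    (hrot : ∀ u : Circle, MeasurePreserving (rotation u) ν ν) (ρ : ℝ) (u : Circle) :
    MeasurePreserving (rotation u) (ν.restrict (Metric.closedBall 0 ρ))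
      (ν.restrict (Metric.closedBall 0 ρ)) := by
  have h := (hrot u).restrict_preimage (measurableSet_closedBall (x := (0 : ℂ)) (ε := ρ))
  have : rotation u ⁻¹' Metric.closedBall 0 ρ = Metric.closedBall 0 ρ := by
    ext z; simp only [Set.mem_preimage, mem_closedBall_zero_iff, LinearIsometryEquiv.norm_map]
  rwa [this] at h

lemma bessel_closedBall [IsFiniteMeasure ν] (hν : ∀ᵐ z ∂ν, ‖z‖ < 1)
    (hrot : ∀ u : Circle, MeasurePreserving (rotation u) ν ν) {a : ℕ → ℂ} {h : ℂ → ℂ}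
    (hh : ∀ z : ℂ, ‖z‖ < 1 → HasSum (fun n => a n * z ^ n) (h z)) {ρ : ℝ} (hρ0 : 0 ≤ ρ)
    (hρ : ρ < 1) (K : ℕ) :
    ∑ i ∈ Finset.range K, ‖a i‖ ^ 2 * ∫ z in Metric.closedBall 0 ρ, ‖z‖ ^ (2 * i) ∂ν ≤
      ∫ z in Metric.closedBall 0 ρ, ‖h z‖ ^ 2 ∂ν := by
  have hsum : Summable fun n => ‖a n‖ * ρ ^ n := by
    have := (hh ρ (by simpa [abs_of_nonneg hρ0] using hρ)).summable.norm
    simpa [abs_of_nonneg hρ0] using this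
  have hbd : ∀ (M : ℕ), ∀ z ∈ Metric.closedBall (0 : ℂ) ρ,
      ‖∑ i ∈ Finset.range M, a i * z ^ i‖ ≤ ∑' n, ‖a n‖ * ρ ^ n := by
    intro M z hz
    rw [mem_closedBall_zero_iff] at hz
    refine (norm_sum_le _ _).trans (le_trans ?_
      (hsum.sum_le_tsum (Finset.range M) fun i _ => by positivity))
    refine Finset.sum_le_sum fun i _ => ?_
    rw [norm_mul, norm_pow]
    gcongr
  have hlim : Filter.Tendsto (fun M : ℕ => ∫ z in Metric.closedBall 0 ρ,
      ‖∑ i ∈ Finset.range M, a i * z ^ i‖ ^ 2 ∂ν) Filter.atTop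
      (nhds (∫ z in Metric.closedBall 0 ρ, ‖h z‖ ^ 2 ∂ν)) := by
    refine tendsto_integral_of_dominated_convergence
      (fun _ => (∑' n, ‖a n‖ * ρ ^ n) ^ 2) (fun M => by fun_prop) (integrable_const _) ?_ ?_
    · intro M
      filter_upwards [ae_restrict_mem measurableSet_closedBall] with z hz
      rw [norm_pow, norm_norm]
      exact pow_le_pow_left₀ (norm_nonneg _) (hbd M z hz) 2
    · filter_upwards [ae_restrict_mem measurableSet_closedBall] with z hz
      exact ((hh z ((mem_closedBall_zero_iff.1 hz).trans_lt hρ)).tendsto_sum_nat.norm.pow 2)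
  refine ge_of_tendsto hlim ?_
  filter_upwards [Filter.eventually_ge_atTop K] with M hM
  rw [integral_norm_sum_sq (ae_restrict_of_ae hν)
    (measurePreserving_rotation_restrict_closedBall hrot ρ)]
  refine Finset.sum_le_sum_of_subset_of_nonneg (Finset.range_mono hM) fun i _ _ => ?_
  exact mul_nonneg (by positivity) (integral_nonneg fun z => by positivity)

lemma bessel_disc [IsFiniteMeasure ν] (hν : ∀ᵐ z ∂ν, ‖z‖ < 1)
    (hrot : ∀ u : Circle, MeasurePreserving (rotation u) ν ν) {a : ℕ → ℂ} {h : ℂ → ℂ}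
    (hh : ∀ z : ℂ, ‖z‖ < 1 → HasSum (fun n => a n * z ^ n) (h z))
    (hint : Integrable (fun z => ‖h z‖ ^ 2) ν) (K : ℕ) :
    ∑ i ∈ Finset.range K, ‖a i‖ ^ 2 * ∫ z, ‖z‖ ^ (2 * i) ∂ν ≤ ∫ z, ‖h z‖ ^ 2 ∂ν := by
  set ρ : ℕ → ℝ := fun j => 1 - 1 / ((j : ℝ) + 1) with hρ
  have hρ0 : ∀ j, 0 ≤ ρ j := fun j => by
    have : (1 : ℝ) / (j + 1) ≤ 1 := by
      rw [div_le_one (by positivity)]; linarith [(j.cast_nonneg : (0 : ℝ) ≤ j)]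
    simp only [hρ]; linarith
  have hρ1 : ∀ j, ρ j < 1 := fun j => by
    have : (0 : ℝ) < 1 / (j + 1) := by positivity
    simp only [hρ]; linarith
  have hmono : Monotone ρ := fun i j hij => by
    have := one_div_le_one_div_of_le (by positivity : (0 : ℝ) < (i : ℝ) + 1)
      (by gcongr : (i : ℝ) + 1 ≤ j + 1)
    simp only [hρ]; linarith
  have hUnion : (⋃ j, Metric.closedBall (0 : ℂ) (ρ j)) =ᵐ[ν] Set.univ := by
    rw [Filter.eventuallyEq_univ]
    filter_upwards [hν] with z hz
    obtain ⟨j, hj⟩ := exists_nat_one_div_lt (sub_pos.2 hz)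
    refine Set.mem_iUnion.2 ⟨j, mem_closedBall_zero_iff.2 ?_⟩
    simp only [hρ]; linarith
  have hmom : ∀ i : ℕ, Filter.Tendsto
      (fun j => ∫ z in Metric.closedBall 0 (ρ j), ‖z‖ ^ (2 * i) ∂ν) Filter.atTop
      (nhds (∫ z, ‖z‖ ^ (2 * i) ∂ν)) := by
    intro i
    have hi : Integrable (fun z : ℂ => ‖z‖ ^ (2 * i)) ν :=
      integrable_of_continuous_of_ae_norm_lt_one hν (by fun_prop)
    have := tendsto_setIntegral_of_monotone (μ := ν) (f := fun z : ℂ => ‖z‖ ^ (2 * i))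
      (fun j => measurableSet_closedBall (x := (0 : ℂ)) (ε := ρ j))
      (fun i j hij => Metric.closedBall_subset_closedBall (hmono hij)) hi.integrableOn
    rwa [setIntegral_congr_set hUnion, setIntegral_univ] at this
  refine le_of_tendsto (tendsto_finsetSum _ fun i _ => (hmom i).const_mul _)
    (Filter.Eventually.of_forall fun j => ?_)
  refine (bessel_closedBall hν hrot hh (hρ0 j) (hρ1 j) K).trans ?_
  exact setIntegral_le_integral hint (Filter.Eventually.of_forall fun z => by positivity)

end RotationInvariant

section FiniteSums

open ComplexConjugate

lemma sum_range_ite_le_sub {M : Type*} [AddCommMonoid M] {L L' s : ℕ} (hL : s + L ≤ L')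
    (h : ℕ → M) (hh : ∀ m, L ≤ m → h m = 0) :
    ∑ N ∈ Finset.range L', (if s ≤ N then h (N - s) else 0) = ∑ m ∈ Finset.range L, h m := by
  obtain ⟨d, rfl⟩ := Nat.exists_eq_add_of_le hL
  rw [add_assoc, Finset.sum_range_add, Finset.sum_eq_zero, zero_add]
  · simp only [Nat.le_add_right, if_true, Nat.add_sub_cancel_left]
    rw [Finset.sum_range_add, Finset.sum_eq_zero (s := Finset.range d), add_zero]
    exact fun i _ => hh _ (Nat.le_add_right _ _)
  · intro i hi
    rw [if_neg (by simpa using hi)]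

/-- The Taylor coefficients of the Bergman projection of `conj ψ * f`, where `P` and `Q` are the
Taylor coefficients of `ψ` and `f`. -/
noncomputable def projCoeff (c : ℕ → ℝ) (P Q : ℕ → ℂ) (m : ℕ) : ℂ :=
  ∑' k, conj (P k) * Q (m + k) * (c (m + k) / c m : ℝ)

/-- The term of index `k` of the coefficient of `z ^ N` in the product of two power series. -/
def mulTerm (P Q : ℕ → ℂ) (N k : ℕ) : ℂ := if k ≤ N then P k * Q (N - k) else 0

variable {c : ℕ → ℝ} {P Q : ℕ → ℂ} {L : ℕ}

lemma projCoeff_eq_sum (hP : ∀ k, L ≤ k → P k = 0) (m : ℕ) :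
    projCoeff c P Q m = ∑ k ∈ Finset.range L, conj (P k) * Q (m + k) * (c (m + k) / c m : ℝ) := by
  refine tsum_eq_sum fun k hk => ?_
  rw [hP k (by simpa using hk)]
  simp

lemma projCoeff_eq_zero (hQ : ∀ n, L ≤ n → Q n = 0) {m : ℕ} (hm : L ≤ m) :
    projCoeff c P Q m = 0 := by
  unfold projCoeff
  convert tsum_zero with k
  rw [hQ (m + k) (by omega)]
  simp

lemma sum_mul_sum_eq_mulTerm (hQ : ∀ n, L ≤ n → Q n = 0) (z : ℂ) :
    (∑ k ∈ Finset.range L, P k * z ^ k) * ∑ n ∈ Finset.range L, Q n * z ^ n =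
      ∑ N ∈ Finset.range (3 * L), (∑ k ∈ Finset.range L, mulTerm P Q N k) * z ^ N := by
  simp_rw [Finset.sum_mul]
  rw [Finset.sum_comm]
  refine Finset.sum_congr rfl fun k hk => ?_
  rw [Finset.mem_range] at hk
  rw [Finset.mul_sum, ← sum_range_ite_le_sub (L' := 3 * L) (s := k) (by omega)
    (fun n => P k * z ^ k * (Q n * z ^ n)) fun m hm => by simp [hQ m hm]]
  refine Finset.sum_congr rfl fun N _ => ?_
  unfold mulTerm
  split_ifs with h
  · obtain ⟨d, rfl⟩ := Nat.exists_eq_add_of_le h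
    rw [Nat.add_sub_cancel_left]; ring
  · simp

lemma sum_extend (hQ : ∀ n, L ≤ n → Q n = 0) (z : ℂ) :
    ∑ n ∈ Finset.range L, Q n * z ^ n = ∑ n ∈ Finset.range (3 * L), Q n * z ^ n := by
  refine Finset.sum_subset (Finset.range_mono (by omega)) fun n _ hn => ?_
  rw [hQ n (by simpa using hn), zero_mul]

lemma sum_mul_conj_mulTerm_projCoeff (hc : ∀ n, 0 < c n) (hP : ∀ k, L ≤ k → P k = 0)
    (hQ : ∀ n, L ≤ n → Q n = 0) :
    ∑ N ∈ Finset.range (3 * L),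
      Q N * conj (∑ k ∈ Finset.range L, mulTerm P (projCoeff c P Q) N k) * (c N : ℂ) =
      ((∑ m ∈ Finset.range L, ‖projCoeff c P Q m‖ ^ 2 * c m : ℝ) : ℂ) := by
  have hm : ∀ m, (‖projCoeff c P Q m‖ : ℂ) ^ 2 * c m = ∑ k ∈ Finset.range L,
      Q (m + k) * conj (P k) * conj (projCoeff c P Q m) * c (m + k) := by
    intro m
    have hcm : (c m : ℂ) ≠ 0 := by exact_mod_cast (hc m).ne'
    rw [← Complex.mul_conj']
    generalize conj (projCoeff c P Q m) = q
    rw [projCoeff_eq_sum hP, Finset.sum_mul, Finset.sum_mul]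
    refine Finset.sum_congr rfl fun k _ => ?_
    push_cast
    field_simp
  push_cast
  simp_rw [hm, map_sum, Finset.mul_sum, Finset.sum_mul]
  rw [Finset.sum_comm]
  conv_rhs => rw [Finset.sum_comm]
  refine Finset.sum_congr rfl fun k hk => ?_
  rw [Finset.mem_range] at hk
  rw [← sum_range_ite_le_sub (L' := 3 * L) (s := k) (by omega)
    (fun m => Q (m + k) * conj (P k) * conj (projCoeff c P Q m) * c (m + k))
    fun m hm => by simp [hQ (m + k) (by omega)]]
  refine Finset.sum_congr rfl fun N _ => ?_
  unfold mulTerm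
  split_ifs with h
  · rw [Nat.sub_add_cancel h, map_mul]; ring
  · simp

lemma sum_norm_projCoeff_sq (hc : ∀ n, 0 < c n) (hP : ∀ k, L ≤ k → P k = 0)
    (hQ : ∀ n, L ≤ n → Q n = 0) :
    ((∑ m ∈ Finset.range L, ‖projCoeff c P Q m‖ ^ 2 * c m : ℝ) : ℂ) =
      ∑ N ∈ Finset.range (3 * L), ∑ k ∈ Finset.range L, ∑ l ∈ Finset.range L,
        ((if k + l ≤ N then c (N - k) * c (N - l) / c (N - (k + l)) else 0 : ℝ) : ℂ) *
          (mulTerm P Q N k * conj (mulTerm P Q N l)) := by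
  have hm : ∀ m, (‖projCoeff c P Q m‖ : ℂ) ^ 2 * c m = ∑ k ∈ Finset.range L,
      ∑ l ∈ Finset.range L, P k * conj (P l) * (Q (m + l) * conj (Q (m + k))) *
        (c (m + l) * c (m + k) / c m) := by
    intro m
    have hcm : (c m : ℂ) ≠ 0 := by exact_mod_cast (hc m).ne'
    rw [← Complex.mul_conj', projCoeff_eq_sum hP, map_sum, mul_comm (Finset.sum _ _),
      Finset.sum_mul_sum, Finset.sum_mul]
    refine Finset.sum_congr rfl fun k _ => ?_
    rw [Finset.sum_mul]
    refine Finset.sum_congr rfl fun l _ => ?_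
    simp only [map_mul, Complex.conj_conj, Complex.conj_ofReal]
    push_cast
    field_simp
  push_cast
  simp_rw [hm]
  rw [Finset.sum_comm, Finset.sum_comm (s := Finset.range (3 * L))]
  refine Finset.sum_congr rfl fun k hk => ?_
  rw [Finset.sum_comm, Finset.sum_comm (s := Finset.range (3 * L))]
  refine Finset.sum_congr rfl fun l hl => ?_
  rw [Finset.mem_range] at hk hl
  rw [← sum_range_ite_le_sub (L' := 3 * L) (s := k + l) (by omega)
    (fun m => P k * conj (P l) * (Q (m + l) * conj (Q (m + k))) *
        ((c (m + l) : ℂ) * c (m + k) / c m))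
    fun m hm => by simp [hQ (m + k) (by omega)]]
  refine Finset.sum_congr rfl fun N _ => ?_
  split_ifs with h
  · obtain ⟨d, rfl⟩ := Nat.exists_eq_add_of_le h
    have e1 : k + l + d - k = d + l := by omega
    have e2 : k + l + d - l = d + k := by omega
    rw [mulTerm, mulTerm, if_pos (by omega), if_pos (by omega), Nat.add_sub_cancel_left, e1, e2,
      map_mul]
    push_cast
    ring
  · simp

lemma sum_mulTerm_weight (hQ : ∀ n, L ≤ n → Q n = 0) :
    ∑ N ∈ Finset.range (3 * L), ∑ k ∈ Finset.range L, k * (‖mulTerm P Q N k‖ ^ 2 * c (N - k)) =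
      (∑ k ∈ Finset.range L, k * ‖P k‖ ^ 2) * ∑ n ∈ Finset.range L, ‖Q n‖ ^ 2 * c n := by
  rw [Finset.sum_comm, Finset.sum_mul]
  refine Finset.sum_congr rfl fun k hk => ?_
  rw [Finset.mem_range] at hk
  rw [Finset.mul_sum, ← sum_range_ite_le_sub (L' := 3 * L) (s := k) (by omega)
    (fun n => k * ‖P k‖ ^ 2 * (‖Q n‖ ^ 2 * c n)) fun m hm => by simp [hQ m hm]]
  refine Finset.sum_congr rfl fun N _ => ?_
  unfold mulTerm
  split_ifs with h
  · rw [norm_mul]; ring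
  · simp

lemma sum_norm_mulTerm_sub_le {α : ℝ} (hα : -1 < α) (hc : ∀ n, 0 < c n)
    (hrec : ∀ n : ℕ, c (n + 1) * (n + α + 2) = (n + 1) * c n) (hP : ∀ k, L ≤ k → P k = 0)
    (hQ : ∀ n, L ≤ n → Q n = 0) :
    (∑ N ∈ Finset.range (3 * L), ‖∑ k ∈ Finset.range L, mulTerm P Q N k‖ ^ 2 * c N) -
      ∑ m ∈ Finset.range L, ‖projCoeff c P Q m‖ ^ 2 * c m ≤
      1 / (2 + α) * ((∑ k ∈ Finset.range L, k * ‖P k‖ ^ 2) *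
        ∑ n ∈ Finset.range L, ‖Q n‖ ^ 2 * c n) := by
  have hcast : (((∑ N ∈ Finset.range (3 * L), ‖∑ k ∈ Finset.range L, mulTerm P Q N k‖ ^ 2 * c N) -
      ∑ m ∈ Finset.range L, ‖projCoeff c P Q m‖ ^ 2 * c m : ℝ) : ℂ) =
      ∑ N ∈ Finset.range (3 * L), ∑ k ∈ Finset.range L, ∑ l ∈ Finset.range L,
        (hankelKernel c N k l : ℂ) * (mulTerm P Q N k * conj (mulTerm P Q N l)) := by
    rw [Complex.ofReal_sub, sum_norm_projCoeff_sq hc hP hQ, Complex.ofReal_sum,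
      ← Finset.sum_sub_distrib]
    refine Finset.sum_congr rfl fun N _ => ?_
    rw [Complex.ofReal_mul, Complex.ofReal_pow, ← Complex.mul_conj', map_sum, Finset.sum_mul_sum,
      Finset.sum_mul, ← Finset.sum_sub_distrib]
    refine Finset.sum_congr rfl fun k _ => ?_
    rw [Finset.sum_mul, ← Finset.sum_sub_distrib]
    refine Finset.sum_congr rfl fun l _ => ?_
    rw [hankelKernel, Complex.ofReal_sub]
    ring
  calc _ ≤ ‖((_ : ℝ) : ℂ)‖ := by rw [Complex.norm_real]; exact Real.le_norm_self _
    _ ≤ ∑ N ∈ Finset.range (3 * L), ∑ k ∈ Finset.range L, ∑ l ∈ Finset.range L,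
        hankelKernel c N k l * (‖mulTerm P Q N k‖ * ‖mulTerm P Q N l‖) := by
      rw [hcast]
      refine norm_sum_le_of_le _ fun N _ => norm_sum_le_of_le _ fun k _ =>
        norm_sum_le_of_le _ fun l _ => le_of_eq ?_
      rw [norm_mul, norm_mul, Complex.norm_conj, Complex.norm_real, Real.norm_of_nonneg
        (hankelKernel_nonneg hα hc hrec N k l)]
    _ ≤ ∑ N ∈ Finset.range (3 * L), 1 / (2 + α) *
        ∑ k ∈ Finset.range L, k * (‖mulTerm P Q N k‖ ^ 2 * c (N - k)) :=
      Finset.sum_le_sum fun N _ => sum_hankelKernel_mul_le hα hc hrec N L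
        (fun k => ‖mulTerm P Q N k‖) fun k hk => by simp [mulTerm, hk.not_ge]
    _ = _ := by rw [← Finset.mul_sum, sum_mulTerm_weight hQ]

lemma norm_conj_mul_sub_sq (p f g : ℂ) :
    ‖conj p * f - g‖ ^ 2 = ‖p * f‖ ^ 2 - 2 * (f * conj (p * g)).re + ‖g‖ ^ 2 := by
  simp only [← Complex.normSq_eq_norm_sq, Complex.normSq_apply, Complex.sub_re, Complex.sub_im,
    Complex.mul_re, Complex.mul_im, Complex.conj_re, Complex.conj_im]
  ring

lemma integral_norm_conj_mul_sub_sq_le {α : ℝ} (hα : -1 < α) (hP : ∀ k, L ≤ k → P k = 0)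
    (hQ : ∀ n, L ≤ n → Q n = 0) :
    ∫ z, ‖conj (∑ k ∈ Finset.range L, P k * z ^ k) * (∑ n ∈ Finset.range L, Q n * z ^ n) -
        ∑ m ∈ Finset.range L, projCoeff (discMoment α) P Q m * z ^ m‖ ^ 2 ∂discMeasure α ≤
      1 / (2 + α) * ((∑ k ∈ Finset.range L, k * ‖P k‖ ^ 2) *
        ∑ n ∈ Finset.range L, ‖Q n‖ ^ 2 * discMoment α n) := by
  have : IsFiniteMeasure (discMeasure α) := isFiniteMeasure_discMeasure hα
  have hν := ae_norm_lt_one (α := α)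
  have hrot := measurePreserving_rotation_discMeasure (α := α)
  have hint : ∀ {h : ℂ → ℝ}, Continuous h → Integrable h (discMeasure α) :=
    integrable_of_continuous_of_ae_norm_lt_one hν
  have hintC : ∀ {h : ℂ → ℂ}, Continuous h → Integrable h (discMeasure α) :=
    integrable_of_continuous_of_ae_norm_lt_one hν
  set p := projCoeff (discMoment α) P Q with hp
  have hp0 : ∀ m, L ≤ m → p m = 0 := fun m hm => projCoeff_eq_zero hQ hm
  have I1 : ∫ z, ‖(∑ k ∈ Finset.range L, P k * z ^ k) * ∑ n ∈ Finset.range L, Q n * z ^ n‖ ^ 2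
      ∂discMeasure α = ∑ N ∈ Finset.range (3 * L),
        ‖∑ k ∈ Finset.range L, mulTerm P Q N k‖ ^ 2 * discMoment α N := by
    simp_rw [sum_mul_sum_eq_mulTerm hQ]
    exact integral_norm_sum_sq hν hrot _ _
  have I2 : ∫ z, ((∑ n ∈ Finset.range L, Q n * z ^ n) * conj ((∑ k ∈ Finset.range L, P k * z ^ k) *
      ∑ m ∈ Finset.range L, p m * z ^ m)).re ∂discMeasure α =
      ∑ m ∈ Finset.range L, ‖p m‖ ^ 2 * discMoment α m := by
    have h := integral_re (μ := discMeasure α) (𝕜 := ℂ) (f := fun z =>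
      (∑ n ∈ Finset.range L, Q n * z ^ n) * conj ((∑ k ∈ Finset.range L, P k * z ^ k) *
      ∑ m ∈ Finset.range L, p m * z ^ m)) (hintC (by fun_prop))
    simp only [RCLike.re_to_complex] at h
    rw [h]
    simp_rw [sum_mul_sum_eq_mulTerm hp0, sum_extend hQ]
    rw [integral_sum_mul_conj_sum hν hrot]
    change (∑ N ∈ Finset.range (3 * L), Q N * conj (∑ k ∈ Finset.range L, mulTerm P p N k) *
      (discMoment α N : ℂ)).re = _
    rw [hp, sum_mul_conj_mulTerm_projCoeff (discMoment_pos hα) hP hQ, Complex.ofReal_re]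
  have I3 : ∫ z, ‖∑ m ∈ Finset.range L, p m * z ^ m‖ ^ 2 ∂discMeasure α =
      ∑ m ∈ Finset.range L, ‖p m‖ ^ 2 * discMoment α m := integral_norm_sum_sq hν hrot _ _
  simp_rw [norm_conj_mul_sub_sq]
  rw [integral_add (hint (by fun_prop)) (hint (by fun_prop)),
    integral_sub (hint (by fun_prop)) (hint (by fun_prop)), integral_const_mul, I1, I2, I3]
  refine le_trans (le_of_eq (by ring)) (sum_norm_mulTerm_sub_le hα (discMoment_pos hα)
    (discMoment_succ hα) hP hQ)

end FiniteSums

section Limits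

open ComplexConjugate Filter Topology

lemma integrable_and_integral_norm_sq_le_of_tendsto {X : Type*} [MeasurableSpace X]
    {ν : Measure X} {F : ℕ → X → ℂ} {G : X → ℂ} {B : ℝ}
    (hFm : ∀ K, AEStronglyMeasurable (F K) ν) (hF : ∀ K, Integrable (fun z => ‖F K z‖ ^ 2) ν)
    (hlim : ∀ᵐ z ∂ν, Tendsto (fun K => F K z) atTop (𝓝 (G z)))
    (hB : ∀ K, ∫ z, ‖F K z‖ ^ 2 ∂ν ≤ B) :
    Integrable (fun z => ‖G z‖ ^ 2) ν ∧ ∫ z, ‖G z‖ ^ 2 ∂ν ≤ B := by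
  have hB0 : 0 ≤ B := (integral_nonneg fun z => by positivity).trans (hB 0)
  have hGm : AEStronglyMeasurable (fun z => ‖G z‖ ^ 2) ν :=
    (aestronglyMeasurable_of_tendsto_ae atTop hFm hlim).norm.pow 2
  have hle : ∫⁻ z, ENNReal.ofReal (‖G z‖ ^ 2) ∂ν ≤ ENNReal.ofReal B := by
    calc _ = ∫⁻ z, liminf (fun K => ENNReal.ofReal (‖F K z‖ ^ 2)) atTop ∂ν := by
          refine lintegral_congr_ae ?_
          filter_upwards [hlim] with z hz
          exact (ENNReal.tendsto_ofReal (hz.norm.pow 2)).liminf_eq.symm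
      _ ≤ liminf (fun K => ∫⁻ z, ENNReal.ofReal (‖F K z‖ ^ 2) ∂ν) atTop :=
          lintegral_liminf_le' fun K => ((hFm K).norm.pow 2).aemeasurable.ennreal_ofReal
      _ ≤ liminf (fun _ : ℕ => ENNReal.ofReal B) atTop := by
          refine liminf_le_liminf (Eventually.of_forall fun K => ?_)
          rw [← ofReal_integral_eq_lintegral_ofReal (hF K)
            (Eventually.of_forall fun z => by positivity)]
          exact ENNReal.ofReal_le_ofReal (hB K)
      _ = _ := liminf_const _
  have hint : Integrable (fun z => ‖G z‖ ^ 2) ν := by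
    refine ⟨hGm, ?_⟩
    rw [hasFiniteIntegral_iff_ofReal (Eventually.of_forall fun z => by positivity)]
    exact hle.trans_lt ENNReal.ofReal_lt_top
  refine ⟨hint, ?_⟩
  rw [← ofReal_integral_eq_lintegral_ofReal hint (Eventually.of_forall fun z => by positivity)]
    at hle
  exact (ENNReal.ofReal_le_ofReal_iff hB0).1 hle

/-- Truncation of a sequence to its first `K` terms. -/
def trunc (a : ℕ → ℂ) (K k : ℕ) : ℂ := if k < K then a k else 0

lemma norm_trunc_le (a : ℕ → ℂ) (K k : ℕ) : ‖trunc a K k‖ ≤ ‖a k‖ := by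
  unfold trunc
  split_ifs <;> simp

lemma tendsto_trunc (a : ℕ → ℂ) (k : ℕ) : Tendsto (fun K => trunc a K k) atTop (𝓝 (a k)) := by
  refine tendsto_const_nhds.congr' ?_
  filter_upwards [eventually_gt_atTop k] with K hK
  simp [trunc, hK]

lemma trunc_eq_zero (a : ℕ → ℂ) {K k : ℕ} (h : K ≤ k) : trunc a K k = 0 := by
  simp [trunc, h.not_gt]

variable {α : ℝ} {c : ℕ → ℝ}

lemma antitone_of_rec (hα : -1 < α) (hc : ∀ n, 0 < c n)
    (hrec : ∀ n : ℕ, c (n + 1) * (n + α + 2) = (n + 1) * c n) : Antitone c := by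
  refine antitone_nat_of_succ_le fun n => ?_
  have hn : (0 : ℝ) ≤ n := n.cast_nonneg
  have h1 := hrec n
  have h2 := hc (n + 1)
  by_contra! h
  have h3 : ((n : ℝ) + 1) * c n < (n + 1) * c (n + 1) := by gcongr
  nlinarith

lemma summable_inv_mul_pow (hc : ∀ n, 0 < c n)
    (hrec : ∀ n : ℕ, c (n + 1) * (n + α + 2) = (n + 1) * c n) {r : ℝ} (hr0 : 0 < r)
    (hr : r < 1) : Summable fun m => (c m)⁻¹ * r ^ m := by
  refine summable_of_ratio_test_tendsto_lt_one hr (Eventually.of_forall fun n => ?_) ?_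
  · have := hc n
    positivity
  · have hratio : ∀ n : ℕ, ‖(c (n + 1))⁻¹ * r ^ (n + 1)‖ / ‖(c n)⁻¹ * r ^ n‖ =
        (1 + (α + 1) * (1 / ((n : ℝ) + 1))) * r := by
      intro n
      have h1 := hc n
      have h2 := hc (n + 1)
      rw [Real.norm_of_nonneg (by positivity), Real.norm_of_nonneg (by positivity), pow_succ]
      field_simp
      linarith [hrec n]
    simp_rw [hratio]
    have := ((tendsto_one_div_add_atTop_nhds_zero_nat (𝕜 := ℝ)).const_mul (α + 1)).const_add 1
    simpa using this.mul_const r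

lemma norm_projCoeff_term_le (hα : -1 < α) (hc : ∀ n, 0 < c n)
    (hrec : ∀ n : ℕ, c (n + 1) * (n + α + 2) = (n + 1) * c n) {a b P Q : ℕ → ℂ}
    (hP : ∀ k, ‖P k‖ ≤ ‖b k‖) (hQ : ∀ n, ‖Q n‖ ≤ ‖a n‖) (m k : ℕ) :
    ‖conj (P k) * Q (m + k) * (c (m + k) / c m : ℝ)‖ ≤
      (c m)⁻¹ * (c 0 * ‖b k‖ ^ 2 + ‖a (m + k)‖ ^ 2 * c (m + k)) := by
  have h1 := hc m
  have h2 := hc (m + k)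
  have h3 : c (m + k) ≤ c 0 := antitone_of_rec hα hc hrec (Nat.zero_le _)
  rw [norm_mul, norm_mul, Complex.norm_conj, Complex.norm_real,
    Real.norm_of_nonneg (by positivity)]
  have h4 : ‖P k‖ * ‖Q (m + k)‖ ≤ ‖b k‖ ^ 2 + ‖a (m + k)‖ ^ 2 := by
    have h5 : ‖P k‖ * ‖Q (m + k)‖ ≤ ‖b k‖ * ‖a (m + k)‖ :=
      mul_le_mul (hP k) (hQ _) (norm_nonneg _) (norm_nonneg _)
    nlinarith [sq_nonneg (‖b k‖ - ‖a (m + k)‖), sq_nonneg (‖b k‖), sq_nonneg (‖a (m + k)‖)]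
  calc ‖P k‖ * ‖Q (m + k)‖ * (c (m + k) / c m)
      ≤ (‖b k‖ ^ 2 + ‖a (m + k)‖ ^ 2) * (c (m + k) / c m) := by gcongr
    _ = (c m)⁻¹ * (c (m + k) * ‖b k‖ ^ 2 + ‖a (m + k)‖ ^ 2 * c (m + k)) := by
        field_simp
    _ ≤ _ := by gcongr

variable {a b : ℕ → ℂ}

lemma summable_projCoeff_bound (hb : Summable fun k => ‖b k‖ ^ 2)
    (ha : Summable fun n => ‖a n‖ ^ 2 * c n) (m : ℕ) :
    Summable fun k => (c m)⁻¹ * (c 0 * ‖b k‖ ^ 2 + ‖a (m + k)‖ ^ 2 * c (m + k)) := by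
  refine ((hb.mul_left _).add ?_).mul_left _
  simpa [add_comm m] using (summable_nat_add_iff m).2 ha

lemma norm_projCoeff_le (hα : -1 < α) (hc : ∀ n, 0 < c n)
    (hrec : ∀ n : ℕ, c (n + 1) * (n + α + 2) = (n + 1) * c n)
    (hb : Summable fun k => ‖b k‖ ^ 2) (ha : Summable fun n => ‖a n‖ ^ 2 * c n)
    {P Q : ℕ → ℂ} (hP : ∀ k, ‖P k‖ ≤ ‖b k‖) (hQ : ∀ n, ‖Q n‖ ≤ ‖a n‖) (m : ℕ) :
    ‖projCoeff c P Q m‖ ≤ (c m)⁻¹ * (c 0 * ∑' k, ‖b k‖ ^ 2 + ∑' n, ‖a n‖ ^ 2 * c n) := by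
  have hs := summable_projCoeff_bound hb ha m
  refine (tsum_of_norm_bounded hs.hasSum
    fun k => norm_projCoeff_term_le hα hc hrec hP hQ m k).trans ?_
  have ha' : Summable fun k => ‖a (m + k)‖ ^ 2 * c (m + k) := by
    simpa [add_comm m] using (summable_nat_add_iff m).2 ha
  rw [tsum_mul_left, (hb.mul_left (c 0)).tsum_add ha', tsum_mul_left]
  have h1 := hc m
  refine mul_le_mul_of_nonneg_left ?_ (inv_nonneg.2 h1.le)
  have := ha.sum_add_tsum_nat_add m
  simp_rw [add_comm m]
  have h0 : 0 ≤ ∑ i ∈ Finset.range m, ‖a i‖ ^ 2 * c i :=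
    Finset.sum_nonneg fun i _ => mul_nonneg (sq_nonneg _) (hc i).le
  linarith

lemma tendsto_projCoeff_trunc (hα : -1 < α) (hc : ∀ n, 0 < c n)
    (hrec : ∀ n : ℕ, c (n + 1) * (n + α + 2) = (n + 1) * c n)
    (hb : Summable fun k => ‖b k‖ ^ 2) (ha : Summable fun n => ‖a n‖ ^ 2 * c n) (m : ℕ) :
    Tendsto (fun K => projCoeff c (trunc b K) (trunc a K) m) atTop (𝓝 (projCoeff c b a m)) := by
  refine tendsto_tsum_of_dominated_convergence (summable_projCoeff_bound hb ha m) (fun k => ?_)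
    (Eventually.of_forall fun K k => norm_projCoeff_term_le hα hc hrec
      (norm_trunc_le b K) (norm_trunc_le a K) m k)
  exact (((Complex.continuous_conj.tendsto _).comp (tendsto_trunc b k)).mul
    (tendsto_trunc a (m + k))).mul_const _

lemma norm_projCoeff_mul_pow_le (hα : -1 < α) (hc : ∀ n, 0 < c n)
    (hrec : ∀ n : ℕ, c (n + 1) * (n + α + 2) = (n + 1) * c n)
    (hb : Summable fun k => ‖b k‖ ^ 2) (ha : Summable fun n => ‖a n‖ ^ 2 * c n)
    {P Q : ℕ → ℂ} (hP : ∀ k, ‖P k‖ ≤ ‖b k‖) (hQ : ∀ n, ‖Q n‖ ≤ ‖a n‖) (m : ℕ) {z : ℂ} {r : ℝ}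
    (hz : ‖z‖ ≤ r) : ‖projCoeff c P Q m * z ^ m‖ ≤
      (c 0 * ∑' k, ‖b k‖ ^ 2 + ∑' n, ‖a n‖ ^ 2 * c n) * ((c m)⁻¹ * r ^ m) := by
  have h := norm_projCoeff_le hα hc hrec hb ha hP hQ m
  rw [norm_mul, norm_pow]
  calc _ ≤ (c m)⁻¹ * (c 0 * ∑' k, ‖b k‖ ^ 2 + ∑' n, ‖a n‖ ^ 2 * c n) * r ^ m := by
        refine mul_le_mul h (pow_le_pow_left₀ (norm_nonneg _) hz m) (by positivity)
          ((norm_nonneg _).trans h)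
    _ = _ := by ring

lemma tendsto_sum_projCoeff_trunc (hα : -1 < α) (hc : ∀ n, 0 < c n)
    (hrec : ∀ n : ℕ, c (n + 1) * (n + α + 2) = (n + 1) * c n)
    (hb : Summable fun k => ‖b k‖ ^ 2) (ha : Summable fun n => ‖a n‖ ^ 2 * c n)
    {z : ℂ} (hz : ‖z‖ < 1) :
    Tendsto (fun K => ∑ m ∈ Finset.range K, projCoeff c (trunc b K) (trunc a K) m * z ^ m) atTop
      (𝓝 (∑' m, projCoeff c b a m * z ^ m)) := by
  obtain ⟨r, hzr, hr⟩ := exists_between hz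
  have hs := summable_inv_mul_pow hc hrec ((norm_nonneg z).trans_lt hzr) hr
  have h : ∀ K, ∑ m ∈ Finset.range K, projCoeff c (trunc b K) (trunc a K) m * z ^ m =
      ∑' m, projCoeff c (trunc b K) (trunc a K) m * z ^ m := by
    intro K
    refine (tsum_eq_sum fun m hm => ?_).symm
    rw [projCoeff_eq_zero (L := K) (fun n hn => trunc_eq_zero a hn) (by simpa using hm), zero_mul]
  simp_rw [h]
  exact tendsto_tsum_of_dominated_convergence (hs.mul_left _)
    (fun m => (tendsto_projCoeff_trunc hα hc hrec hb ha m).mul_const _)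
    (Eventually.of_forall fun K m => norm_projCoeff_mul_pow_le hα hc hrec hb ha
      (norm_trunc_le b K) (norm_trunc_le a K) m hzr.le)

lemma differentiableOn_tsum_projCoeff (hα : -1 < α) (hc : ∀ n, 0 < c n)
    (hrec : ∀ n : ℕ, c (n + 1) * (n + α + 2) = (n + 1) * c n)
    (hb : Summable fun k => ‖b k‖ ^ 2) (ha : Summable fun n => ‖a n‖ ^ 2 * c n) :
    DifferentiableOn ℂ (fun z => ∑' m, projCoeff c b a m * z ^ m) (Metric.ball 0 1) := by
  intro z hz
  obtain ⟨r, hzr, hr⟩ := exists_between (mem_ball_zero_iff.1 hz)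
  have hs := summable_inv_mul_pow hc hrec ((norm_nonneg z).trans_lt hzr) hr
  have hd : DifferentiableOn ℂ (fun z => ∑' m, projCoeff c b a m * z ^ m) (Metric.ball 0 r) := by
    refine differentiableOn_tsum_of_summable_norm (hs.mul_left _) (fun m => by fun_prop)
      Metric.isOpen_ball fun m w hw => norm_projCoeff_mul_pow_le hα hc hrec hb ha
        (fun _ => le_rfl) (fun _ => le_rfl) m (mem_ball_zero_iff.1 hw).le
  exact (hd.differentiableAt (Metric.isOpen_ball.mem_nhds
    (mem_ball_zero_iff.2 hzr))).differentiableWithinAt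

end Limits

section Main

open ComplexConjugate Filter Topology

lemma hasSum_taylor_disc {h : ℂ → ℂ} (hh : DifferentiableOn ℂ h (Metric.ball 0 1)) {z : ℂ}
    (hz : ‖z‖ < 1) : HasSum (fun n : ℕ => iteratedDeriv n h 0 / n.factorial * z ^ n) (h z) := by
  have := Complex.hasSum_taylorSeries_on_ball hh (mem_ball_zero_iff.2 hz)
  simp only [sub_zero, smul_eq_mul] at this
  have e : (fun n : ℕ => iteratedDeriv n h 0 / n.factorial * z ^ n) =
      fun n : ℕ => (n.factorial : ℂ)⁻¹ * (z ^ n * iteratedDeriv n h 0) := by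
    ext n
    ring
  rwa [e]

lemma sum_mul_norm_taylor_sq_le {ψ : ℂ → ℂ} (hψ : DifferentiableOn ℂ ψ (Metric.ball 0 1))
    (hψ'2 : IntegrableOn (fun z => ‖deriv ψ z‖ ^ 2) (Metric.ball (0 : ℂ) 1)) (K : ℕ) :
    ∑ k ∈ Finset.range K, k * ‖iteratedDeriv k ψ 0 / k.factorial‖ ^ 2 ≤
      Real.pi⁻¹ * ∫ z in Metric.ball (0 : ℂ) 1, ‖deriv ψ z‖ ^ 2 := by
  have h0 : (-1 : ℝ) < 0 := by norm_num
  have := isFiniteMeasure_discMeasure h0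
  have hd := hψ.deriv Metric.isOpen_ball
  have hbes := bessel_disc ae_norm_lt_one measurePreserving_rotation_discMeasure
    (fun z hz => hasSum_taylor_disc hd hz)
    ((integrable_discMeasure_iff h0 _).2 (by simpa using hψ'2)) (K - 1)
  rw [integral_discMeasure_eq h0] at hbes
  simp only [add_zero, Real.rpow_zero, mul_one] at hbes
  rw [le_inv_mul_iff₀ Real.pi_pos]
  refine le_trans (le_of_eq ?_) hbes
  rcases K with _ | K
  · simp
  rw [Finset.sum_range_succ', Nat.add_sub_cancel, Nat.cast_zero, zero_mul, add_zero,
    Finset.mul_sum]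
  refine Finset.sum_congr rfl fun n _ => ?_
  change _ = _ * discMoment 0 n
  rw [discMoment_zero_left, ← iteratedDeriv_succ', norm_div, norm_div, Nat.factorial_succ]
  have hn : (0 : ℝ) < (n : ℝ) + 1 := by positivity
  have hf : (0 : ℝ) < n.factorial := by positivity
  simp only [Complex.norm_natCast]
  push_cast
  field_simp

lemma exists_bergman_approx {α : ℝ} (hα : -1 < α) {ψ f : ℂ → ℂ}
    (hψ : DifferentiableOn ℂ ψ (Metric.ball 0 1)) (hf : DifferentiableOn ℂ f (Metric.ball 0 1))
    (hf2 : Integrable (fun z => ‖f z‖ ^ 2) (discMeasure α))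
    (hψ'2 : IntegrableOn (fun z => ‖deriv ψ z‖ ^ 2) (Metric.ball (0 : ℂ) 1))
    (hψf : Integrable (fun z => ‖ψ z‖ ^ 2 * ‖f z‖ ^ 2) (discMeasure α)) :
    ∃ g : ℂ → ℂ, DifferentiableOn ℂ g (Metric.ball 0 1) ∧
      Integrable (fun z => ‖g z‖ ^ 2) (discMeasure α) ∧
      ∫ z, ‖conj (ψ z) * f z - g z‖ ^ 2 ∂discMeasure α ≤
        1 / ((2 + α) * Real.pi) * (∫ z in Metric.ball (0 : ℂ) 1, ‖deriv ψ z‖ ^ 2) *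
          ∫ z, ‖f z‖ ^ 2 ∂discMeasure α := by
  have hfin := isFiniteMeasure_discMeasure hα
  have hc := discMoment_pos hα
  have hrec := discMoment_succ hα
  set c := discMoment α with hcdef
  set b : ℕ → ℂ := fun n => iteratedDeriv n ψ 0 / n.factorial with hbdef
  set a : ℕ → ℂ := fun n => iteratedDeriv n f 0 / n.factorial with hadef
  have hbK : ∀ K, ∑ k ∈ Finset.range K, k * ‖b k‖ ^ 2 ≤
      Real.pi⁻¹ * ∫ z in Metric.ball (0 : ℂ) 1, ‖deriv ψ z‖ ^ 2 :=
    sum_mul_norm_taylor_sq_le hψ hψ'2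
  have haK : ∀ K, ∑ n ∈ Finset.range K, ‖a n‖ ^ 2 * c n ≤ ∫ z, ‖f z‖ ^ 2 ∂discMeasure α :=
    bessel_disc ae_norm_lt_one measurePreserving_rotation_discMeasure
      (fun z hz => hasSum_taylor_disc hf hz) hf2
  have ha : Summable fun n => ‖a n‖ ^ 2 * c n :=
    summable_of_sum_range_le (fun n => mul_nonneg (sq_nonneg _) (hc n).le) haK
  have hb : Summable fun k => ‖b k‖ ^ 2 := by
    have h1 : Summable fun k : ℕ => k * ‖b k‖ ^ 2 :=
      summable_of_sum_range_le (fun k => by positivity) hbK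
    refine (summable_nat_add_iff 1).1 (((summable_nat_add_iff 1).2 h1).of_nonneg_of_le
      (fun k => by positivity) fun k => ?_)
    refine le_mul_of_one_le_left (by positivity) ?_
    push_cast
    linarith [(k.cast_nonneg : (0 : ℝ) ≤ k)]
  have hgd := differentiableOn_tsum_projCoeff hα hc hrec hb ha
  set g : ℂ → ℂ := fun z => ∑' m, projCoeff c b a m * z ^ m with hg
  have hpart : ∀ (u : ℕ → ℂ) (K : ℕ) (z : ℂ), ∑ k ∈ Finset.range K, trunc u K k * z ^ k =
      ∑ k ∈ Finset.range K, u k * z ^ k := fun u K z =>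
    Finset.sum_congr rfl fun k hk => by rw [trunc, if_pos (Finset.mem_range.1 hk)]
  have hlim : ∀ᵐ z ∂discMeasure α, Tendsto (fun K =>
      conj (∑ k ∈ Finset.range K, trunc b K k * z ^ k) *
        (∑ n ∈ Finset.range K, trunc a K n * z ^ n) -
        ∑ m ∈ Finset.range K, projCoeff c (trunc b K) (trunc a K) m * z ^ m) atTop
      (𝓝 (conj (ψ z) * f z - g z)) := by
    filter_upwards [ae_norm_lt_one (α := α)] with z hz
    simp_rw [hpart]
    exact (((Complex.continuous_conj.tendsto _).comp
      (hasSum_taylor_disc hψ hz).tendsto_sum_nat).mul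
      (hasSum_taylor_disc hf hz).tendsto_sum_nat).sub
      (tendsto_sum_projCoeff_trunc hα hc hrec hb ha hz)
  obtain ⟨hint, hle⟩ := integrable_and_integral_norm_sq_le_of_tendsto
    (fun K => Continuous.aestronglyMeasurable (by fun_prop))
    (fun K => integrable_of_continuous_of_ae_norm_lt_one ae_norm_lt_one (by fun_prop)) hlim
    (B := 1 / (2 + α) * ((Real.pi⁻¹ * ∫ z in Metric.ball (0 : ℂ) 1, ‖deriv ψ z‖ ^ 2) *
      ∫ z, ‖f z‖ ^ 2 ∂discMeasure α)) (fun K => by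
      refine (integral_norm_conj_mul_sub_sq_le hα (fun k hk => trunc_eq_zero b hk)
        (fun n hn => trunc_eq_zero a hn)).trans ?_
      have h2 : 0 ≤ 1 / (2 + α) := one_div_nonneg.2 (by linarith)
      refine mul_le_mul_of_nonneg_left (mul_le_mul (le_trans ?_ (hbK K)) (le_trans ?_ (haK K))
        ?_ ?_) h2
      · refine Finset.sum_le_sum fun k _ => ?_
        have := norm_trunc_le b K k
        gcongr
      · refine Finset.sum_le_sum fun n _ => ?_
        have := norm_trunc_le a K n
        have := (hc n).le
        gcongr
      · exact Finset.sum_nonneg fun n _ => mul_nonneg (sq_nonneg _) (hc n).le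
      · have : 0 ≤ ∫ z in Metric.ball (0 : ℂ) 1, ‖deriv ψ z‖ ^ 2 :=
          integral_nonneg fun z => by positivity
        have := Real.pi_pos
        positivity)
  refine ⟨g, hgd, ?_, hle.trans (le_of_eq ?_)⟩
  · have hgm : AEStronglyMeasurable g (discMeasure α) :=
      aestronglyMeasurable_of_tendsto_ae atTop
        (f := fun K z => ∑ m ∈ Finset.range K, projCoeff c (trunc b K) (trunc a K) m * z ^ m)
        (fun K => Continuous.aestronglyMeasurable (by fun_prop)) (by
        filter_upwards [ae_norm_lt_one (α := α)] with z hz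
        exact tendsto_sum_projCoeff_trunc hα hc hrec hb ha hz)
    refine ((hψf.const_mul 2).add (hint.const_mul 2)).mono' (hgm.norm.pow 2)
      (Eventually.of_forall fun z => ?_)
    have h1 : ‖g z‖ ≤ ‖conj (ψ z) * f z‖ + ‖conj (ψ z) * f z - g z‖ := by
      simpa using norm_sub_le (conj (ψ z) * f z) (conj (ψ z) * f z - g z)
    have h2 : ‖ψ z‖ ^ 2 * ‖f z‖ ^ 2 = ‖conj (ψ z) * f z‖ ^ 2 := by
      rw [norm_mul, Complex.norm_conj, mul_pow]
    rw [norm_pow, norm_norm, Pi.add_apply, h2]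
    nlinarith [norm_nonneg (g z), sq_nonneg (‖conj (ψ z) * f z‖ - ‖conj (ψ z) * f z - g z‖)]
  · have : 2 + α ≠ 0 := by linarith
    have := Real.pi_ne_zero
    field_simp

end Main

end HankelBergman

/-- Sharp Hankel estimate on the weighted Bergman space `A²_α(𝔻)` for `α > -1`:
the weighted `L²`-distance from `conj(ψ)·f` to `A²_α(𝔻)` is controlled by
`(1/((2+α)π)) ‖ψ'‖²_{A²} ‖f‖²_α`. -/
theorem hankel_estimate_weighted_bergman_disc
    (α : ℝ) (hα : -1 < α)
    (W : ℂ → ℝ) (hW : ∀ z : ℂ, W z = (1 + α) * (1 - ‖z‖ ^ 2) ^ α)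
    (ψ f : ℂ → ℂ)
    (hψ : DifferentiableOn ℂ ψ (Metric.ball (0 : ℂ) 1))
    (hf : DifferentiableOn ℂ f (Metric.ball (0 : ℂ) 1))
    (hf2 : IntegrableOn (fun z => ‖f z‖ ^ 2 * W z) (Metric.ball (0 : ℂ) 1) volume)
    (hψ'2 : IntegrableOn (fun z => ‖deriv ψ z‖ ^ 2) (Metric.ball (0 : ℂ) 1) volume)
    (hψf : IntegrableOn (fun z => ‖ψ z‖ ^ 2 * ‖f z‖ ^ 2 * W z)
      (Metric.ball (0 : ℂ) 1) volume) :
    ⨅ g : {g : ℂ → ℂ // DifferentiableOn ℂ g (Metric.ball (0 : ℂ) 1) ∧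
        IntegrableOn (fun z => ‖g z‖ ^ 2 * W z) (Metric.ball (0 : ℂ) 1) volume},
      ∫ z in Metric.ball (0 : ℂ) 1, ‖(starRingEnd ℂ) (ψ z) * f z - g.1 z‖ ^ 2 * W z ≤
    (1 / ((2 + α) * Real.pi)) * (∫ z in Metric.ball (0 : ℂ) 1, ‖deriv ψ z‖ ^ 2) *
      (∫ z in Metric.ball (0 : ℂ) 1, ‖f z‖ ^ 2 * W z) := by
  obtain ⟨g, hgd, hg2, hg⟩ := HankelBergman.exists_bergman_approx hα hψ hf
    ((HankelBergman.integrable_discMeasure_iff hα _).2 (by simpa only [hW] using hf2)) hψ'2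
    ((HankelBergman.integrable_discMeasure_iff hα _).2 (by simpa only [hW] using hψf))
  have hg2' : IntegrableOn (fun z => ‖g z‖ ^ 2 * W z) (Metric.ball (0 : ℂ) 1) volume := by
    simpa only [hW] using (HankelBergman.integrable_discMeasure_iff hα _).1 hg2
  refine (ciInf_le ⟨0, ?_⟩ ⟨g, hgd, hg2'⟩).trans ?_
  · rintro _ ⟨h, rfl⟩
    refine setIntegral_nonneg measurableSet_ball fun z hz => ?_
    have hz1 : ‖z‖ < 1 := mem_ball_zero_iff.1 hz
    rw [hW]
    exact mul_nonneg (sq_nonneg _) (mul_nonneg (by linarith)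
      (Real.rpow_nonneg (by nlinarith [norm_nonneg z]) _))
  · rw [HankelBergman.integral_discMeasure_eq hα, HankelBergman.integral_discMeasure_eq hα] at hg
    simpa only [hW] using hg
end

section
/- Let α > −1 be real and let W_α(z) = (1+α)(1−|z|²)^α for z ∈ 𝔻. Then the infimum, over all holomorphic functions g on 𝔻 with ∫_𝔻 |g|² W_α dxdy < ∞, of ∫_𝔻 |conj(z) − g(z)|² W_α(z) dxdy equals π/(2+α). (This shows the main estimate ‖H_{conj ψ}‖ ≤ ‖ψ'‖_{A²(𝔻)}/√(2+α) is sharp, attained by ψ(z) = z and f ≡ 1.) -/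
open MeasureTheory Complex

/-- The integral of a holomorphic function times `z`, over a circle centred at `0`, vanishes. -/
lemma integral_circleMap_mul_eq_zero {g : ℂ → ℂ}
    (hg : DifferentiableOn ℂ g (Metric.ball (0 : ℂ) 1)) {r : ℝ} (hr : 0 < r) (hr1 : r < 1) :
    ∫ θ in Set.Ioo (-Real.pi) Real.pi, circleMap 0 r θ * g (circleMap 0 r θ) = 0 := by
  have hd : DiffContOnCl ℂ g (Metric.ball (0 : ℂ) r) := by
    refine DifferentiableOn.diffContOnCl ?_
    rw [closure_ball 0 hr.ne']
    exact hg.mono (Metric.closedBall_subset_ball hr1)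
  have h := hd.circleIntegral_eq_zero hr.le
  simp only [circleIntegral, deriv_circleMap, smul_eq_mul] at h
  have h' : ∫ θ in (0 : ℝ)..2 * Real.pi, circleMap 0 r θ * g (circleMap 0 r θ) = 0 := by
    have : (fun θ : ℝ => circleMap 0 r θ * I * g (circleMap 0 r θ)) =
        fun θ : ℝ => I * (circleMap 0 r θ * g (circleMap 0 r θ)) := by
      ext θ; ring
    rw [this, intervalIntegral.integral_const_mul] at h
    exact (mul_eq_zero.mp h).resolve_left I_ne_zero
  have hp : Function.Periodic (fun θ : ℝ => circleMap 0 r θ * g (circleMap 0 r θ))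
      (2 * Real.pi) := fun θ => by simp only [periodic_circleMap 0 r θ]
  have h2 := hp.intervalIntegral_add_eq (-Real.pi) 0
  rw [zero_add, h', show -Real.pi + 2 * Real.pi = Real.pi by ring,
    intervalIntegral.integral_of_le (by linarith [Real.pi_pos])] at h2
  rw [← integral_Ioc_eq_integral_Ioo, h2]

/-- A holomorphic function on the disc vanishing at the origin, written as `z * g z`, is orthogonal
to every radial weight. -/
lemma setIntegral_ball_mul_radial_eq_zero {g : ℂ → ℂ}
    (hg : DifferentiableOn ℂ g (Metric.ball (0 : ℂ) 1)) (w : ℝ → ℝ) :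
    ∫ z in Metric.ball (0 : ℂ) 1, z * g z * (w ‖z‖ : ℂ) = 0 := by
  rw [← integral_indicator measurableSet_ball, ← Complex.integral_comp_polarCoord_symm]
  set F : ℝ × ℝ → ℂ := fun p => p.1 • (Metric.ball (0 : ℂ) 1).indicator
    (fun z => z * g z * (w ‖z‖ : ℂ)) (Complex.polarCoord.symm p) with hF
  by_cases hint : IntegrableOn F polarCoord.target
  swap
  · exact integral_undef hint
  rw [polarCoord_target] at hint ⊢
  rw [Measure.volume_eq_prod] at hint ⊢
  rw [setIntegral_prod F hint]
  refine (setIntegral_congr_fun measurableSet_Ioi fun r (hr : 0 < r) => ?_).trans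
    (integral_zero _ _)
  have hpt (θ : ℝ) : Complex.polarCoord.symm (r, θ) = circleMap 0 r θ := by
    simp [circleMap, Complex.exp_mul_I]
  have hn (θ : ℝ) : ‖circleMap 0 r θ‖ = r := by simp [abs_of_pos hr]
  by_cases hr1 : r < 1
  · have : ∀ θ : ℝ, F (r, θ) =
        (r * w r : ℂ) * (circleMap 0 r θ * g (circleMap 0 r θ)) := fun θ => by
      have hm : circleMap 0 r θ ∈ Metric.ball (0 : ℂ) 1 := by simpa [abs_of_pos hr] using hr1
      simp only [hF, hpt, Set.indicator_of_mem hm, hn, Complex.real_smul]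
      ring
    simp only [this]
    rw [integral_const_mul, integral_circleMap_mul_eq_zero hg hr hr1, mul_zero]
  · have : ∀ θ : ℝ, F (r, θ) = 0 := fun θ => by
      have hm : circleMap 0 r θ ∉ Metric.ball (0 : ℂ) 1 := by simpa [abs_of_pos hr] using hr1
      simp only [hF, hpt, Set.indicator_of_notMem hm, smul_zero]
    simp only [this, integral_zero]

lemma integral_cube_mul_one_sub_sq_rpow {α : ℝ} (hα : -1 < α) :
    ∫ r in (0 : ℝ)..1, r * (r ^ 2 * ((1 + α) * (1 - r ^ 2) ^ α)) = 1 / (2 * (2 + α)) := by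
  have h1 : 0 < α + 1 := by linarith
  have h2 : 0 < α + 2 := by linarith
  set f : ℝ → ℝ := fun r => -(1 + α) / 2 *
    ((1 - r ^ 2) ^ (α + 1) / (α + 1) - (1 - r ^ 2) ^ (α + 2) / (α + 2)) with hf
  have hcont : ContinuousOn f (Set.Icc 0 1) := by
    refine Continuous.continuousOn ?_
    have hb : Continuous fun r : ℝ => 1 - r ^ 2 := by fun_prop
    exact continuous_const.mul (((hb.rpow_const fun _ => Or.inr h1.le).div_const _).sub
      ((hb.rpow_const fun _ => Or.inr h2.le).div_const _))
  have hpos : ∀ r ∈ Set.Ioo (0 : ℝ) 1, 0 < 1 - r ^ 2 := fun r hr => by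
    nlinarith [hr.1, hr.2]
  have hderiv : ∀ r ∈ Set.Ioo (0 : ℝ) 1,
      HasDerivAt f (r * (r ^ 2 * ((1 + α) * (1 - r ^ 2) ^ α))) r := fun r hr => by
    have hu := hpos r hr
    have hb : HasDerivAt (fun r : ℝ => 1 - r ^ 2) (-(2 * r)) r := by
      simpa using ((hasDerivAt_id r).pow 2).const_sub 1
    have key := (((hb.rpow_const (p := α + 1) (Or.inl hu.ne')).div_const (α + 1)).sub
      ((hb.rpow_const (p := α + 2) (Or.inl hu.ne')).div_const (α + 2))).const_mul (-(1 + α) / 2)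
    refine key.congr_deriv ?_
    rw [show α + 1 - 1 = α by ring, show α + 2 - 1 = α + 1 by ring, Real.rpow_add_one hu.ne']
    field_simp
    ring
  have hnn : ∀ r ∈ Set.Ioo (0 : ℝ) 1, 0 ≤ r * (r ^ 2 * ((1 + α) * (1 - r ^ 2) ^ α)) :=
    fun r hr => by
      have := Real.rpow_nonneg (hpos r hr).le α
      have := hr.1.le
      have : 0 ≤ 1 + α := by linarith
      positivity
  have hint : IntervalIntegrable (fun r : ℝ => r * (r ^ 2 * ((1 + α) * (1 - r ^ 2) ^ α)))
      volume 0 1 := by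
    rw [intervalIntegrable_iff_integrableOn_Ioc_of_le zero_le_one]
    exact intervalIntegral.integrableOn_deriv_of_nonneg hcont hderiv hnn
  rw [intervalIntegral.integral_eq_sub_of_hasDerivAt_of_le zero_le_one hcont hderiv hint]
  simp only [hf]
  norm_num [Real.zero_rpow h1.ne', Real.zero_rpow h2.ne']
  rw [add_comm 2 α]
  field_simp
  ring

lemma setIntegral_ball_norm_sq_mul_one_sub_norm_sq_rpow {α : ℝ} (hα : -1 < α) :
    ∫ z in Metric.ball (0 : ℂ) 1, ‖z‖ ^ 2 * ((1 + α) * (1 - ‖z‖ ^ 2) ^ α) =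
      Real.pi / (2 + α) := by
  set f : ℝ → ℝ := fun r => r ^ 2 * ((1 + α) * (1 - r ^ 2) ^ α) with hf
  have h : ∀ z : ℂ, (Metric.ball (0 : ℂ) 1).indicator
      (fun z : ℂ => ‖z‖ ^ 2 * ((1 + α) * (1 - ‖z‖ ^ 2) ^ α)) z = (Set.Iio 1).indicator f ‖z‖ :=
    fun z => by simp [Set.indicator, hf]
  have h' : ∀ r : ℝ, r ^ (2 - 1) • (Set.Iio 1).indicator f r =
      (Set.Iio 1).indicator (fun r => r * f r) r := fun r => by
    simp [Set.indicator]
  rw [← integral_indicator measurableSet_ball]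
  simp only [h]
  rw [integral_fun_norm_addHaar volume ((Set.Iio 1).indicator f), Complex.finrank_real_complex]
  simp only [h']
  rw [setIntegral_indicator measurableSet_Iio, Set.Ioi_inter_Iio, ← integral_Ioc_eq_integral_Ioo,
    ← intervalIntegral.integral_of_le zero_le_one, integral_cube_mul_one_sub_sq_rpow hα,
    Measure.real, Complex.volume_ball]
  have : 2 + α ≠ 0 := by linarith
  simp
  field_simp

/-- Sharpness of the main estimate: for `α > -1`, the weighted `L²_α`-distance
from `conj(z)` to the weighted Bergman space `A²_α(𝔻)` equals `π/(2+α)`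
(attained by `ψ(z) = z`, `f ≡ 1`). -/
theorem hankel_sharpness_weighted_bergman_disc
    (α : ℝ) (hα : -1 < α)
    (W : ℂ → ℝ) (hW : ∀ z : ℂ, W z = (1 + α) * (1 - ‖z‖ ^ 2) ^ α) :
    ⨅ g : {g : ℂ → ℂ // DifferentiableOn ℂ g (Metric.ball (0 : ℂ) 1) ∧
        IntegrableOn (fun z => ‖g z‖ ^ 2 * W z) (Metric.ball (0 : ℂ) 1) volume},
      ∫ z in Metric.ball (0 : ℂ) 1, ‖(starRingEnd ℂ) z - g.1 z‖ ^ 2 * W z =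
    Real.pi / (2 + α) := by
  obtain rfl : W = fun z => (1 + α) * (1 - ‖z‖ ^ 2) ^ α := funext hW
  clear hW
  set B := Metric.ball (0 : ℂ) 1 with hB
  set w : ℝ → ℝ := fun r => (1 + α) * (1 - r ^ 2) ^ α with hw
  have hA : ∫ z in B, ‖z‖ ^ 2 * w ‖z‖ = Real.pi / (2 + α) :=
    setIntegral_ball_norm_sq_mul_one_sub_norm_sq_rpow hα
  have hApos : 0 < Real.pi / (2 + α) := div_pos Real.pi_pos (by linarith)
  have hAint : IntegrableOn (fun z : ℂ => ‖z‖ ^ 2 * w ‖z‖) B :=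
    Integrable.of_integral_ne_zero (by rw [hA]; exact hApos.ne')
  have hwnn : ∀ z ∈ B, 0 ≤ w ‖z‖ := fun z hz => by
    have hz1 : ‖z‖ < 1 := by simpa [hB] using hz
    have : 0 ≤ 1 - ‖z‖ ^ 2 := by nlinarith [norm_nonneg z]
    exact mul_nonneg (by linarith) (Real.rpow_nonneg this α)
  have hlb : ∀ g : ℂ → ℂ, DifferentiableOn ℂ g B →
      IntegrableOn (fun z => ‖g z‖ ^ 2 * w ‖z‖) B volume →
      Real.pi / (2 + α) ≤ ∫ z in B, ‖(starRingEnd ℂ) z - g z‖ ^ 2 * w ‖z‖ := by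
    intro g hg hgint
    have hwm : Measurable fun z : ℂ => (w ‖z‖ : ℂ) := by
      simp only [hw]; fun_prop
    have hcross : IntegrableOn (fun z => z * g z * (w ‖z‖ : ℂ)) B := by
      refine Integrable.mono' (hAint.add hgint) ?_ ?_
      · exact (aestronglyMeasurable_id.mul
          (hg.continuousOn.aestronglyMeasurable measurableSet_ball)).mul
          hwm.aestronglyMeasurable
      · filter_upwards [ae_restrict_mem measurableSet_ball] with z hz
        have := hwnn z hz
        simp only [norm_mul, Complex.norm_real, Real.norm_eq_abs, abs_of_nonneg this, Pi.add_apply]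
        rw [← add_mul]
        gcongr
        nlinarith [sq_nonneg (‖z‖ - ‖g z‖), sq_nonneg ‖z‖, sq_nonneg ‖g z‖]
    have hre : ∫ z in B, (z * g z * (w ‖z‖ : ℂ)).re = 0 := by
      have := integral_re hcross
      simp only [RCLike.re_to_complex] at this
      rw [this, setIntegral_ball_mul_radial_eq_zero hg w, Complex.zero_re]
    have hexp : ∀ z : ℂ, ‖(starRingEnd ℂ) z - g z‖ ^ 2 * w ‖z‖ =
        ‖z‖ ^ 2 * w ‖z‖ + ‖g z‖ ^ 2 * w ‖z‖ - 2 * (z * g z * (w ‖z‖ : ℂ)).re := fun z => by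
      rw [Complex.re_mul_ofReal]
      simp only [← Complex.normSq_eq_norm_sq]
      simp only [Complex.normSq_apply, Complex.sub_re, Complex.sub_im, Complex.conj_re,
        Complex.conj_im, Complex.mul_re]
      ring
    simp only [hexp]
    have hsum : IntegrableOn (fun z => ‖z‖ ^ 2 * w ‖z‖ + ‖g z‖ ^ 2 * w ‖z‖) B := hAint.add hgint
    have hcrossre : IntegrableOn (fun z => 2 * (z * g z * (w ‖z‖ : ℂ)).re) B :=
      hcross.re.const_mul 2
    rw [integral_sub hsum hcrossre, integral_add hAint hgint,
      integral_const_mul, hre, hA, mul_zero, sub_zero]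
    refine le_add_of_nonneg_right (setIntegral_nonneg measurableSet_ball fun z hz => ?_)
    exact mul_nonneg (sq_nonneg _) (hwnn z hz)
  refine le_antisymm ?_ ?_
  · refine (ciInf_le ⟨Real.pi / (2 + α), ?_⟩
      ⟨0, differentiableOn_const 0, by simp⟩).trans (le_of_eq ?_)
    · rintro _ ⟨g, rfl⟩
      exact hlb g.1 g.2.1 g.2.2
    · simpa using hA
  · have : Nonempty {g : ℂ → ℂ // DifferentiableOn ℂ g B ∧
        IntegrableOn (fun z => ‖g z‖ ^ 2 * ((1 + α) * (1 - ‖z‖ ^ 2) ^ α)) B volume} :=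
      ⟨0, differentiableOn_const 0, by simp⟩
    exact le_ciInf fun g => hlb g.1 g.2.1 g.2.2
end
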